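/- arXiv:2004.10833 — 8 statements merged into one kernel-verified Lean document; each statement's English description precedes it below -/
import Mathlib

section
/- Let 0 < α < 1 and a < b be real numbers. Suppose f : ℝ → ℝ is absolutely continuous on [a,b], i.e. there is f′ ∈ L¹((a,b)) with f(x) = f(a) + ∫_a^x f′(y) dy for all x ∈ [a,b], and suppose φ : ℝ → ℝ is continuously differentiable with φ(0) = 0 and with φ′ Lipschitz continuous. Define q : ℝ → ℝ by q(x) = φ(f(x))/f(x) if f(x) ≠ 0 and q(x) = φ′(0) if f(x) = 0. Then for almost every x ∈ (a,b) one has the chain rule identity (1/Γ(1−α))·[ φ(f(a))·(x−a)^{−α} + ∫_a^x φ′(f(y)) f′(y) (x−y)^{−α} dy ] = q(x)·(1/Γ(1−α))·[ f(a)·(x−a)^{−α} + ∫_a^x f′(y) (x−y)^{−α} dy ] + (α/Γ(1−α)) ∫_a^x f(y)·(q(x) − q(y))·(x−y)^{−1−α} dy, where both sides are absolutely convergent integrals. -/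
open MeasureTheory Real Set
open scoped ENNReal

theorem chain_aux (a b : ℝ) (hab : a < b) (F f' : ℝ → ℝ) (C : ℝ)
    (hf' : IntervalIntegrable f' volume a b)
    (hF : ∀ x, F x = C + ∫ y in a..x, f' y) (φ : ℝ → ℝ) (hφ : ContDiff ℝ 1 φ)
    (c d : ℝ) (hc : c ∈ Icc a b) (hd : d ∈ Icc a b) :
    φ (F d) - φ (F c) = ∫ t in c..d, deriv φ (F t) * f' t := by
  have hFe : F = fun x => C + ∫ y in a..x, f' y := funext hF
  have hI : AbsolutelyContinuousOnInterval (fun x => ∫ y in a..x, f' y) a b :=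
    hf'.absolutelyContinuousOnInterval_intervalIntegral (c := a) (by simp)
  have hcst : AbsolutelyContinuousOnInterval (fun _ : ℝ => C) a b :=
    (contDiff_const.contDiffOn).absolutelyContinuousOnInterval
  have hFac : AbsolutelyContinuousOnInterval F a b := by
    rw [hFe]; exact hcst.fun_add hI
  obtain ⟨M, hM⟩ := hFac.exists_bound
  obtain ⟨K, hK⟩ := (hφ.contDiffOn (s := Icc (-M) M)).exists_lipschitzOnWith (by decide)
    (convex_Icc _ _) isCompact_Icc
  have hFm : ∀ x ∈ uIcc a b, F x ∈ Icc (-M) M := fun x hx => by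
    have := hM x hx
    rw [Real.norm_eq_abs, abs_le] at this
    exact this
  have hφF : AbsolutelyContinuousOnInterval (fun x => φ (F x)) a b := by
    have h0 := hFac
    unfold AbsolutelyContinuousOnInterval at h0 ⊢
    apply squeeze_zero' ?_ ?_ (by simpa using h0.const_mul (K : ℝ))
    · exact Filter.Eventually.of_forall <| fun _ ↦ Finset.sum_nonneg (fun i hi ↦ dist_nonneg)
    have : AbsolutelyContinuousOnInterval.disjWithin a b ∈
        AbsolutelyContinuousOnInterval.totalLengthFilter ⊓
          Filter.principal (AbsolutelyContinuousOnInterval.disjWithin a b) :=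
      Filter.mem_inf_of_right (Filter.mem_principal_self _)
    filter_upwards [this] with E hE
    rw [Finset.mul_sum]
    refine Finset.sum_le_sum fun i hi => ?_
    have := hE.1 i hi
    exact hK.dist_le_mul _ (hFm _ this.1) _ (hFm _ this.2)
  have hsub : uIcc c d ⊆ uIcc a b := by
    rw [uIcc_of_le hab.le]; exact uIcc_subset_Icc hc hd
  rw [← (hφF.mono hsub).integral_deriv_eq_sub]
  apply intervalIntegral.integral_congr_ae
  filter_upwards [hf'.ae_hasDerivAt_integral] with x hx hx2
  have hx3 : x ∈ uIcc a b := hsub (uIoc_subset_uIcc hx2)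
  have h1 : HasDerivAt F (f' x) x := by
    rw [hFe]; exact (hx hx3 a (by simp)).const_add C
  have h2 : HasDerivAt φ (deriv φ (F x)) (F x) :=
    (hφ.differentiable (by decide) _).hasDerivAt
  exact (h2.comp x h1).deriv

theorem kernel_int (α a x t : ℝ) (hα₀ : 0 < α) (hat : a ≤ t) (htx : t < x) :
    IntegrableOn (fun y => (x - y) ^ (-(1 : ℝ) - α)) (Ioo a t) ∧
    ∫ y in Ioo a t, (x - y) ^ (-(1 : ℝ) - α) = ((x - t) ^ (-α) - (x - a) ^ (-α)) / α := by
  have hcont : ContinuousOn (fun y => (x - y) ^ (-(1 : ℝ) - α)) (uIcc a t) := by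
    intro y hy
    rw [uIcc_of_le hat] at hy
    have : x - y ≠ 0 := by have := hy.2; linarith
    exact ((continuous_const.sub continuous_id).continuousAt.rpow_const
      (Or.inl this)).continuousWithinAt
  have hii := hcont.intervalIntegrable (μ := volume)
  refine ⟨((intervalIntegrable_iff_integrableOn_Ioo_of_le hat).1 hii), ?_⟩
  rw [← integral_Ioc_eq_integral_Ioo, ← intervalIntegral.integral_of_le hat]
  rw [intervalIntegral.integral_eq_sub_of_hasDerivAt (f := fun y => (x - y) ^ (-α) / α) _ hii]
  · ring
  · intro y hy
    rw [uIcc_of_le hat] at hy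
    have hp : x - y ≠ 0 := by have := hy.2; linarith
    have h := (((hasDerivAt_id y).const_sub x).rpow_const (p := -α) (Or.inl hp)).div_const α
    simp only [id] at h
    have e : (x - y) ^ (-(1 : ℝ) - α) = -1 * -α * (x - y) ^ (-α - 1) / α := by
      rw [show -α - 1 = -1 - α by ring]
      field_simp
    rw [e]
    exact h

theorem core_aux (α a x : ℝ) (hα₀ : 0 < α) (hax : a < x) (g G : ℝ → ℝ)
    (hg : IntegrableOn g (Ioo a x))
    (hgk : IntegrableOn (fun y => g y * (x - y) ^ (-α)) (Ioo a x))
    (hG : ∀ y ∈ Ico a x, G y = - ∫ t in Ioo y x, g t) :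
    IntegrableOn (fun y => G y * (x - y) ^ (-(1 : ℝ) - α)) (Ioo a x) ∧
    α * ∫ y in Ioo a x, G y * (x - y) ^ (-(1 : ℝ) - α) =
      - (G a * (x - a) ^ (-α) + ∫ y in Ioo a x, g y * (x - y) ^ (-α)) := by
  set μ := (volume : Measure ℝ).restrict (Ioo a x) with hμ
  let S : Set (ℝ × ℝ) := {p | p.1 < p.2}
  have hS : MeasurableSet S := measurableSet_lt measurable_fst measurable_snd
  let K : ℝ × ℝ → ℝ := S.indicator (fun p => g p.2 * (x - p.1) ^ (-(1 : ℝ) - α))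
  have hKm : AEStronglyMeasurable K (μ.prod μ) := by
    refine AEStronglyMeasurable.indicator ?_ hS
    refine hg.1.comp_snd.mul ?_
    exact Measurable.aestronglyMeasurable (by fun_prop)
  have hsl : ∀ t, (fun y => K (y, t)) =
      (Iio t).indicator (fun y => g t * (x - y) ^ (-(1 : ℝ) - α)) := by
    intro t; ext y; simp [K, S, indicator]
  have hsl2 : ∀ y, (fun t => K (y, t)) =
      (Ioi y).indicator (fun t => g t * (x - y) ^ (-(1 : ℝ) - α)) := by
    intro t; ext y; simp [K, S, indicator]
  have hset : ∀ t ∈ Ioo a x, Iio t ∩ Ioo a x = Ioo a t := by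
    intro t ht; ext y; simp only [mem_inter_iff, mem_Iio, mem_Ioo]
    constructor
    · rintro ⟨h1, h2, h3⟩; exact ⟨h2, h1⟩
    · rintro ⟨h1, h2⟩; exact ⟨h2, h1, h2.trans ht.2⟩
  have hset2 : ∀ y ∈ Ioo a x, Ioi y ∩ Ioo a x = Ioo y x := by
    intro t ht; ext y; simp only [mem_inter_iff, mem_Ioi, mem_Ioo]
    constructor
    · rintro ⟨h1, h2, h3⟩; exact ⟨h1, h3⟩
    · rintro ⟨h1, h2⟩; exact ⟨h1, ht.1.trans h1, h2⟩
  have hn : ∀ t ∈ Ioo a x, ∫ y, ‖K (y, t)‖ ∂μ = ‖g t‖ * (((x - t) ^ (-α) - (x - a) ^ (-α)) / α) := by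
    intro t ht
    have : (fun y => ‖K (y, t)‖) =
      (Iio t).indicator (fun y => ‖g t * (x - y) ^ (-(1 : ℝ) - α)‖) := by
      ext y
      rw [show K (y, t) = _ from congrFun (hsl t) y, norm_indicator_eq_indicator_norm]
    rw [this, integral_indicator measurableSet_Iio, hμ, Measure.restrict_restrict measurableSet_Iio,
      hset t ht, ← (kernel_int α a x t hα₀ ht.1.le ht.2).2, ← integral_const_mul]
    refine setIntegral_congr_fun measurableSet_Ioo fun y hy => ?_
    have : 0 ≤ (x - y) ^ (-(1 : ℝ) - α) := rpow_nonneg (by linarith [hy.2, ht.2]) _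
    simp only [norm_mul]
    rw [Real.norm_of_nonneg this]
  have hi : ∀ t ∈ Ioo a x, ∫ y, K (y, t) ∂μ = g t * (((x - t) ^ (-α) - (x - a) ^ (-α)) / α) := by
    intro t ht
    rw [hsl, integral_indicator measurableSet_Iio, hμ, Measure.restrict_restrict measurableSet_Iio,
      hset t ht, ← (kernel_int α a x t hα₀ ht.1.le ht.2).2, ← integral_const_mul]
  have hi2 : ∀ y ∈ Ioo a x, ∫ t, K (y, t) ∂μ = - (G y * (x - y) ^ (-(1 : ℝ) - α)) := by
    intro y hy
    rw [hsl2, integral_indicator measurableSet_Ioi, hμ, Measure.restrict_restrict measurableSet_Ioi,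
      hset2 y hy, integral_mul_const, hG y ⟨hy.1.le, hy.2⟩]
    ring
  have hmem : ∀ᵐ t ∂μ, t ∈ Ioo a x := ae_restrict_mem measurableSet_Ioo
  have hKi : Integrable K (μ.prod μ) := by
    rw [integrable_prod_iff' hKm]
    constructor
    · filter_upwards [hmem] with t ht
      rw [hsl, integrable_indicator_iff measurableSet_Iio, IntegrableOn, hμ,
        Measure.restrict_restrict measurableSet_Iio, hset t ht]
      exact (kernel_int α a x t hα₀ ht.1.le ht.2).1.const_mul _
    · have h1 : Integrable (fun t => (‖g t * (x - t) ^ (-α)‖ - ‖g t‖ * (x - a) ^ (-α)) / α) μ :=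
        (hgk.norm.sub (hg.norm.mul_const _)).div_const α
      refine h1.congr ?_
      filter_upwards [hmem] with t ht
      rw [hn t ht, norm_mul, Real.norm_of_nonneg (rpow_nonneg (by linarith [ht.2]) (-α))]
      ring
  have hL := hKi.integral_prod_left
  have hae : (fun y => ∫ t, K (y, t) ∂μ) =ᵐ[μ] fun y => - (G y * (x - y) ^ (-(1 : ℝ) - α)) := by
    filter_upwards [hmem] with y hy using hi2 y hy
  refine ⟨?_, ?_⟩
  · have := (hL.congr hae).neg
    simpa [IntegrableOn, Pi.neg_def] using this
  · have e := integral_integral_swap (f := fun y t => K (y, t)) (μ := μ) (ν := μ) hKi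
    rw [integral_congr_ae hae, integral_neg] at e
    have e2 : ∫ t, ∫ y, K (y, t) ∂μ ∂μ = ∫ t, (g t * (x - t) ^ (-α) - g t * (x - a) ^ (-α)) / α ∂μ := by
      apply integral_congr_ae
      filter_upwards [hmem] with t ht
      rw [hi t ht]; ring
    rw [e2, integral_div, integral_sub hgk (hg.mul_const _), integral_mul_const] at e
    have e3 := hG a ⟨le_rfl, hax⟩
    rw [← hμ] at e3
    have e4 : ∫ y, G y * (x - y) ^ (-(1 : ℝ) - α) ∂μ =
      - ((∫ t, g t * (x - t) ^ (-α) ∂μ - (∫ t, g t ∂μ) * (x - a) ^ (-α)) / α) := by linarith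
    rw [e4, e3]
    field_simp
    ring

theorem ae_aux (α a b : ℝ) (hα₁ : α < 1) (hab : a < b) (f' : ℝ → ℝ)
    (hf' : IntegrableOn f' (Ioo a b)) :
    ∀ᵐ x : ℝ, x ∈ Ioo a b → IntegrableOn (fun y => f' y * (x - y) ^ (-α)) (Ioo a x) := by
  let k : ℝ → ℝ := (Ioo 0 (b - a)).indicator (fun s => s ^ (-α))
  have hk : Integrable k := by
    rw [integrable_indicator_iff measurableSet_Ioo]
    exact (intervalIntegrable_iff_integrableOn_Ioo_of_le (by linarith)).1
      (intervalIntegral.intervalIntegrable_rpow' (by linarith))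
  have hh : Integrable ((Ioo a b).indicator f') := (integrable_indicator_iff measurableSet_Ioo).2 hf'
  filter_upwards [hh.ae_convolution_exists (ContinuousLinearMap.mul ℝ ℝ) hk] with x hx hxm
  have h := (hx : Integrable _ _).integrableOn (s := Ioo a x)
  refine h.congr_fun (fun y hy => ?_) measurableSet_Ioo
  have h1 : y ∈ Ioo a b := ⟨hy.1, hy.2.trans hxm.2⟩
  have h2 : x - y ∈ Ioo 0 (b - a) := ⟨by linarith [hy.2], by linarith [hy.1, hxm.2]⟩
  simp [k, indicator_of_mem h1, indicator_of_mem h2]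

theorem stmt_1 (α a b : ℝ) (hα₀ : 0 < α) (hα₁ : α < 1) (hab : a < b)
    (f f' : ℝ → ℝ) (hf' : IntegrableOn f' (Set.Ioo a b))
    (hfa : ∀ x ∈ Set.Icc a b, f x = f a + ∫ y in Set.Ioo a x, f' y)
    (φ : ℝ → ℝ) (hφ : ContDiff ℝ 1 φ) (hφ0 : φ 0 = 0)
    (L : NNReal) (hlip : LipschitzWith L (deriv φ))
    (q : ℝ → ℝ)
    (hq : ∀ x, q x = if f x = 0 then deriv φ 0 else φ (f x) / f x) :
    ∀ᵐ x : ℝ, x ∈ Set.Ioo a b →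
      IntegrableOn (fun y => deriv φ (f y) * f' y * (x - y) ^ (-α)) (Set.Ioo a x) ∧
      IntegrableOn (fun y => f' y * (x - y) ^ (-α)) (Set.Ioo a x) ∧
      IntegrableOn (fun y => f y * (q x - q y) * (x - y) ^ (-(1 : ℝ) - α)) (Set.Ioo a x) ∧
      (1 / Real.Gamma (1 - α)) *
          (φ (f a) * (x - a) ^ (-α) +
            ∫ y in Set.Ioo a x, deriv φ (f y) * f' y * (x - y) ^ (-α)) =
        q x * ((1 / Real.Gamma (1 - α)) *
            (f a * (x - a) ^ (-α) + ∫ y in Set.Ioo a x, f' y * (x - y) ^ (-α))) +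
          (α / Real.Gamma (1 - α)) *
            ∫ y in Set.Ioo a x, f y * (q x - q y) * (x - y) ^ (-(1 : ℝ) - α) := by
  have hii : IntervalIntegrable f' volume a b :=
    (intervalIntegrable_iff_integrableOn_Ioo_of_le hab.le).2 hf'
  let F : ℝ → ℝ := fun x => f a + ∫ y in a..x, f' y
  have hfF : ∀ x ∈ Icc a b, f x = F x := by
    intro x hx
    rw [hfa x hx]
    simp only [F]
    rw [intervalIntegral.integral_of_le hx.1, integral_Ioc_eq_integral_Ioo]
  have hFc : ContinuousOn F (Icc a b) := by
    have := (hii.absolutelyContinuousOnInterval_intervalIntegral (c := a) (by simp)).continuousOn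
    rw [uIcc_of_le hab.le] at this
    exact continuousOn_const.add this
  have hfc : ContinuousOn f (Icc a b) := hFc.congr hfF
  have hdc : ContinuousOn (fun y => deriv φ (f y)) (Icc a b) :=
    hlip.continuous.comp_continuousOn hfc
  obtain ⟨M, hM⟩ := isCompact_Icc.exists_bound_of_continuousOn hdc
  have key : ∀ ψ : ℝ → ℝ, ContDiff ℝ 1 ψ → ∀ y ∈ Icc a b, ∀ x ∈ Icc a b, y ≤ x →
      ψ (f x) - ψ (f y) = ∫ t in Ioo y x, deriv ψ (f t) * f' t := by
    intro ψ hψ y hy x hx hyx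
    rw [hfF x hx, hfF y hy, chain_aux a b hab F f' (f a) hii (fun _ => rfl) ψ hψ y x hy hx,
      intervalIntegral.integral_of_le hyx, integral_Ioc_eq_integral_Ioo]
    refine setIntegral_congr_fun measurableSet_Ioo fun t ht => ?_
    rw [hfF t ⟨hy.1.trans ht.1.le, ht.2.le.trans hx.2⟩]
  have hqm : ∀ y, φ (f y) = f y * q y := by
    intro y
    rw [hq]
    split_ifs with h
    · rw [h, hφ0]; simp
    · field_simp
  have hbd : ∀ x ∈ Ioo a b, ∀ h : ℝ → ℝ, IntegrableOn h (Ioo a x) →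
      IntegrableOn (fun y => deriv φ (f y) * h y) (Ioo a x) := by
    intro x hx h hh
    have hsub : Ioo a x ⊆ Icc a b := fun y hy => ⟨hy.1.le, hy.2.le.trans hx.2.le⟩
    refine Integrable.bdd_mul (c := M) hh
      ((hdc.mono hsub).aestronglyMeasurable measurableSet_Ioo) ?_
    filter_upwards [ae_restrict_mem measurableSet_Ioo] with y hy using hM y (hsub hy)
  filter_upwards [ae_aux α a b hα₁ hab f' hf'] with x hx hxm
  have h2 := hx hxm
  have h1 : IntegrableOn (fun y => deriv φ (f y) * f' y * (x - y) ^ (-α)) (Ioo a x) := by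
    simpa only [mul_assoc] using hbd x hxm _ h2
  have hf'x : IntegrableOn f' (Ioo a x) := hf'.mono_set (Ioo_subset_Ioo_right hxm.2.le)
  have hg1 := hbd x hxm _ hf'x
  have hxI : x ∈ Icc a b := Ioo_subset_Icc_self hxm
  have hc := core_aux α a x hα₀ hxm.1 (fun t => deriv φ (f t) * f' t - q x * f' t)
    (fun y => φ (f y) - q x * f y) (hg1.sub (hf'x.const_mul _))
    (by
      have := h1.sub (h2.const_mul (q x))
      refine this.congr ?_
      filter_upwards with y
      simp only [Pi.sub_apply]
      ring)
    (by
      intro y hy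
      have hyI : y ∈ Icc a b := ⟨hy.1, hy.2.le.trans hxI.2⟩
      have hss : Ioo y x ⊆ Ioo a x := Ioo_subset_Ioo_left hy.1
      rw [integral_sub (hg1.mono_set hss) ((hf'x.mono_set hss).const_mul _), integral_const_mul,
        ← key φ hφ y hyI x hxI hy.2.le]
      have k2 := key id contDiff_id y hyI x hxI hy.2.le
      simp only [id, deriv_id, one_mul] at k2
      rw [← k2, hqm x]
      ring)
  have hfun : (fun y => f y * (q x - q y) * (x - y) ^ (-(1 : ℝ) - α)) =
      fun y => - ((φ (f y) - q x * f y) * (x - y) ^ (-(1 : ℝ) - α)) := by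
    ext y; rw [hqm y]; ring
  refine ⟨h1, h2, ?_, ?_⟩
  · rw [hfun]; exact hc.1.neg
  · rw [hfun, integral_neg]
    have e := hc.2
    have e1 : ∫ y in Ioo a x, (deriv φ (f y) * f' y - q x * f' y) * (x - y) ^ (-α) =
        (∫ y in Ioo a x, deriv φ (f y) * f' y * (x - y) ^ (-α)) -
          q x * ∫ y in Ioo a x, f' y * (x - y) ^ (-α) := by
      rw [← integral_const_mul, ← integral_sub h1 (h2.const_mul _)]
      congr 1; ext y; ring
    rw [e1] at e
    linear_combination (1 / Real.Gamma (1 - α)) * e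
end

section
/- Let 0 < α < 1, let a < b be real numbers, and let f, F ∈ L¹((a,b)) (Lebesgue measure). Then the following two assertions are equivalent: (i) there exists c ∈ ℝ such that (1/Γ(1−α)) ∫_a^x F(y) (x−y)^{−α} dy = c + ∫_a^x f(y) dy for almost every x ∈ (a,b); (ii) there exists c′ ∈ ℝ such that F(x) = c′·(x−a)^{α−1} + (1/Γ(α)) ∫_a^x f(y) (x−y)^{α−1} dy for almost every x ∈ (a,b). -/
open MeasureTheory Real Set
open scoped ENNReal

lemma beta_aux (σ y x : ℝ) (h0 : 0 < σ) (h1 : σ < 1) (hyx : y < x) :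
    ∫ z in Ioo y x, (z - y) ^ (σ - 1) * (x - z) ^ (-σ) = Gamma σ * Gamma (1 - σ) := by
  have h := Complex.betaIntegral_scaled (σ : ℂ) ((1 - σ : ℝ) : ℂ) (sub_pos.2 hyx)
  rw [Complex.betaIntegral_eq_Gamma_mul_div _ _ (by simpa) (by simpa)] at h
  have e1 : (σ : ℂ) + ((1 - σ : ℝ) : ℂ) = 1 := by push_cast; ring
  rw [e1, Complex.Gamma_one, sub_self, Complex.cpow_zero, one_mul, div_one,
    Complex.Gamma_ofReal, Complex.Gamma_ofReal] at h
  have h2 : ∫ t in (0:ℝ)..(x - y), t ^ (σ - 1) * ((x - y) - t) ^ (-σ)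
      = Gamma σ * Gamma (1 - σ) := by
    have : ((∫ t in (0:ℝ)..(x - y), t ^ (σ - 1) * ((x - y) - t) ^ (-σ) : ℝ) : ℂ)
      = ((Gamma σ * Gamma (1 - σ) : ℝ) : ℂ) := by
      rw [← intervalIntegral.integral_ofReal, Complex.ofReal_mul, ← h]
      apply intervalIntegral.integral_congr
      intro t ht
      rw [uIcc_of_le (sub_pos.2 hyx).le] at ht
      simp only
      rw [Complex.ofReal_mul, Complex.ofReal_cpow ht.1, Complex.ofReal_cpow (sub_nonneg.2 ht.2)]
      push_cast
      congr 2
      ring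
    exact_mod_cast this
  rw [← integral_Ioc_eq_integral_Ioo, ← intervalIntegral.integral_of_le hyx.le, ← h2]
  have := intervalIntegral.integral_comp_sub_right
    (fun t => t ^ (σ - 1) * ((x - y) - t) ^ (-σ)) y (a := y) (b := x)
  rw [sub_self] at this
  rw [← this]
  congr 1; ext z
  congr 2; ring

lemma beta_int (σ y x : ℝ) (h0 : 0 < σ) (h1 : σ < 1) (hyx : y < x) :
    IntegrableOn (fun z => (z - y) ^ (σ - 1) * (x - z) ^ (-σ)) (Ioo y x) := by
  by_contra h
  have h2 := beta_aux σ y x h0 h1 hyx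
  rw [integral_undef h] at h2
  have := mul_pos (Gamma_pos_of_pos h0) (Gamma_pos_of_pos (sub_pos.2 h1))
  linarith

noncomputable def HK (σ x : ℝ) (g : ℝ → ℝ) (z y : ℝ) : ℝ :=
  g y * (Ioi y).indicator (fun z => (z - y) ^ (σ - 1) * (x - z) ^ (-σ)) z

lemma HK_left (σ a x y : ℝ) (g : ℝ → ℝ) (h0 : 0 < σ) (h1 : σ < 1)
    (hy : y ∈ Ioo a x) :
    Integrable (fun z => HK σ x g z y) (volume.restrict (Ioo a x)) ∧
    ∫ z in Ioo a x, HK σ x g z y = Gamma σ * Gamma (1 - σ) * g y := by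
  have e : Ioo a x ∩ Ioi y = Ioo y x := by
    ext z; simp only [mem_inter_iff, mem_Ioo, mem_Ioi]
    exact ⟨fun h => ⟨h.2, h.1.2⟩, fun h => ⟨⟨hy.1.trans h.1, h.2⟩, h.1⟩⟩
  constructor
  · unfold HK
    apply Integrable.const_mul
    rw [integrable_indicator_iff measurableSet_Ioi, IntegrableOn,
      Measure.restrict_restrict measurableSet_Ioi, inter_comm, e]
    exact beta_int σ y x h0 h1 hy.2
  · unfold HK
    rw [integral_const_mul, setIntegral_indicator measurableSet_Ioi, e,
      beta_aux σ y x h0 h1 hy.2, mul_comm]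

lemma HK_norm (σ a x y : ℝ) (g : ℝ → ℝ) {z : ℝ} (hz : z ∈ Ioo a x) :
    ‖HK σ x g z y‖ = HK σ x (fun y => ‖g y‖) z y := by
  unfold HK
  rw [norm_mul]
  congr 1
  rw [norm_of_nonneg]
  by_cases h : y < z
  · rw [indicator_of_mem (by exact h)]
    exact mul_nonneg (rpow_nonneg (sub_pos.2 h).le _) (rpow_nonneg (sub_pos.2 hz.2).le _)
  · rw [indicator_of_notMem (by exact h)]

lemma HK_prod (σ a x : ℝ) (g : ℝ → ℝ) (h0 : 0 < σ) (h1 : σ < 1)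
    (hg : IntegrableOn g (Ioo a x)) :
    Integrable (Function.uncurry (HK σ x g))
      ((volume.restrict (Ioo a x)).prod (volume.restrict (Ioo a x))) := by
  rw [integrable_prod_iff']
  · constructor
    · filter_upwards [ae_restrict_mem measurableSet_Ioo] with y hy
      exact (HK_left σ a x y g h0 h1 hy).1
    · refine (hg.norm.const_mul (Gamma σ * Gamma (1 - σ))).congr ?_
      filter_upwards [ae_restrict_mem measurableSet_Ioo] with y hy
      refine (HK_left σ a x y (fun y => ‖g y‖) h0 h1 hy).2.symm.trans ?_
      exact setIntegral_congr_fun measurableSet_Ioo (fun z hz => (HK_norm σ a x y g hz).symm)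
  · have : Function.uncurry (HK σ x g) = fun p : ℝ × ℝ => g p.2 *
      ({q : ℝ × ℝ | q.2 < q.1}.indicator (fun q => (q.1 - q.2) ^ (σ - 1) * (x - q.1) ^ (-σ)) p) := by
      ext p; rfl
    rw [this]
    refine hg.aestronglyMeasurable.comp_snd.mul ?_
    apply Measurable.aestronglyMeasurable
    refine Measurable.indicator (by fun_prop) (measurableSet_lt measurable_snd measurable_fst)

lemma HK_right (σ a x z : ℝ) (g : ℝ → ℝ) (hz : z ∈ Ioo a x) :
    HK σ x g z = (Iio z).indicator (fun y => (g y * (z - y) ^ (σ - 1)) * (x - z) ^ (-σ)) := by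
  ext y
  unfold HK
  by_cases h : y < z
  · rw [indicator_of_mem (by exact h), indicator_of_mem (by exact h)]; ring
  · rw [indicator_of_notMem (by exact h), indicator_of_notMem (by exact h)]; ring

lemma HK_right_inter (a x z : ℝ) (hz : z ∈ Ioo a x) : Ioo a x ∩ Iio z = Ioo a z := by
  ext y; simp only [mem_inter_iff, mem_Ioo, mem_Iio]
  exact ⟨fun h => ⟨h.1.1, h.2⟩, fun h => ⟨⟨h.1, h.2.trans hz.2⟩, h.2⟩⟩

lemma HK_right_int (σ a x z : ℝ) (g : ℝ → ℝ) (hz : z ∈ Ioo a x) :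
    ∫ y in Ioo a x, HK σ x g z y
      = (∫ y in Ioo a z, g y * (z - y) ^ (σ - 1)) * (x - z) ^ (-σ) := by
  rw [HK_right σ a x z g hz, setIntegral_indicator measurableSet_Iio, HK_right_inter a x z hz,
    integral_mul_const]

lemma ker_int (σ a b : ℝ) (g : ℝ → ℝ) (h0 : 0 < σ) (h1 : σ < 1)
    (hg : IntegrableOn g (Ioo a b)) :
    ∀ᵐ x : ℝ, x ∈ Ioo a b → IntegrableOn (fun y => g y * (x - y) ^ (σ - 1)) (Ioo a x) := by
  rw [← ae_restrict_iff' measurableSet_Ioo]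
  filter_upwards [(HK_prod σ a b g h0 h1 hg).prod_right_ae, ae_restrict_mem measurableSet_Ioo]
    with z hz hzm
  change Integrable (HK σ b g z) _ at hz
  rw [HK_right σ a b z g hzm, integrable_indicator_iff measurableSet_Iio, IntegrableOn,
      Measure.restrict_restrict measurableSet_Iio, inter_comm, HK_right_inter a b z hzm] at hz
  have hp : (b - z) ^ (-σ) ≠ 0 := (rpow_pos_of_pos (sub_pos.2 hzm.2) _).ne'
  refine (hz.mul_const ((b - z) ^ (-σ))⁻¹).congr (ae_of_all _ fun y => ?_)
  simp only
  rw [mul_inv_cancel_right₀ hp]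

lemma frac_int' (σ a x : ℝ) (g : ℝ → ℝ) (h0 : 0 < σ) (h1 : σ < 1)
    (hg : IntegrableOn g (Ioo a x)) :
    IntegrableOn (fun z => (∫ y in Ioo a z, g y * (z - y) ^ (σ - 1)) * (x - z) ^ (-σ))
      (Ioo a x) := by
  refine (HK_prod σ a x g h0 h1 hg).integral_prod_left.congr ?_
  filter_upwards [ae_restrict_mem measurableSet_Ioo] with z hz
  exact HK_right_int σ a x z g hz

lemma frac_int (σ a x : ℝ) (g : ℝ → ℝ) (h0 : 0 < σ) (h1 : σ < 1)
    (hg : IntegrableOn g (Ioo a x)) :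
    IntegrableOn (fun z => ∫ y in Ioo a z, g y * (z - y) ^ (σ - 1)) (Ioo a x) := by
  have h := (frac_int' σ a x g h0 h1 hg).mul_bdd (c := (x - a) ^ σ) (g := fun z => (x - z) ^ σ)
    (by apply Measurable.aestronglyMeasurable; fun_prop) ?_
  · refine h.congr ?_
    filter_upwards [ae_restrict_mem measurableSet_Ioo] with z hz
    rw [mul_assoc, ← rpow_add (sub_pos.2 hz.2)]
    simp
  · filter_upwards [ae_restrict_mem measurableSet_Ioo] with z hz
    have := sub_pos.2 hz.2
    rw [norm_of_nonneg (rpow_nonneg this.le _)]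
    exact rpow_le_rpow this.le (by linarith [hz.1]) h0.le

lemma semi (σ a x : ℝ) (g : ℝ → ℝ) (h0 : 0 < σ) (h1 : σ < 1)
    (hg : IntegrableOn g (Ioo a x)) :
    ∫ z in Ioo a x, (∫ y in Ioo a z, g y * (z - y) ^ (σ - 1)) * (x - z) ^ (-σ)
      = Gamma σ * Gamma (1 - σ) * ∫ y in Ioo a x, g y := by
  have h := integral_integral_swap (HK_prod σ a x g h0 h1 hg)
  rw [← integral_const_mul]
  convert h using 1
  · exact setIntegral_congr_fun measurableSet_Ioo (fun z hz => (HK_right_int σ a x z g hz).symm)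
  · exact setIntegral_congr_fun measurableSet_Ioo
      (fun y hy => (HK_left σ a x y g h0 h1 hy).2.symm)

lemma ae_zero (a b : ℝ) (h : ℝ → ℝ) (hh : IntegrableOn h (Ioo a b))
    (h0 : ∀ᵐ x : ℝ, x ∈ Ioo a b → ∫ y in Ioo a x, h y = 0) :
    ∀ᵐ x : ℝ, x ∈ Ioo a b → h x = 0 := by
  rcases le_or_gt b a with hab | hab
  · simp [Ioo_eq_empty_of_le hab]
  have hi : IntervalIntegrable h volume a b := by
    rwa [intervalIntegrable_iff_integrableOn_Ioo_of_le hab.le]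
  have hc : ContinuousOn (fun x => ∫ y in a..x, h y) (Ioo a b) :=
    (intervalIntegral.continuousOn_primitive_interval
      (by rwa [uIcc_of_le hab.le, integrableOn_Icc_iff_integrableOn_Ioo])).mono
      (by rw [uIcc_of_le hab.le]; exact Ioo_subset_Icc_self)
  have hz : EqOn (fun x => ∫ y in a..x, h y) (fun _ => 0) (Ioo a b) := by
    refine Measure.eqOn_open_of_ae_eq (μ := volume) ?_ isOpen_Ioo hc continuousOn_const
    refine (ae_restrict_iff' measurableSet_Ioo).2 ?_
    filter_upwards [h0] with x hx hm
    rw [intervalIntegral.integral_of_le hm.1.le, integral_Ioc_eq_integral_Ioo, hx hm]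
  filter_upwards [hi.ae_hasDerivAt_integral] with x hx hm
  have hd := hx (by rw [uIcc_of_le hab.le]; exact Ioo_subset_Icc_self hm) a left_mem_uIcc
  have he : (fun x => ∫ y in a..x, h y) =ᶠ[nhds x] fun _ => 0 := by
    filter_upwards [isOpen_Ioo.mem_nhds hm] with t ht using hz ht
  exact (hd.congr_of_eventuallyEq he.symm).unique (hasDerivAt_const x 0)

lemma pow_int (σ a b : ℝ) (h0 : 0 < σ) :
    IntegrableOn (fun x => (x - a) ^ (σ - 1)) (Ioo a b) := by
  rcases le_or_gt b a with hab | hab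
  · simp [Ioo_eq_empty_of_le hab]
  rw [← intervalIntegrable_iff_integrableOn_Ioo_of_le hab.le]
  have := (intervalIntegral.intervalIntegrable_rpow' (a := 0) (b := b - a)
    (by linarith : -1 < σ - 1)).comp_sub_right a
  simpa using this

/-- (ii) implies that the fractional integral of order 1 - α is explicit. -/
lemma frac_rhs (α a b c : ℝ) (h0 : 0 < α) (h1 : α < 1)
    (f : ℝ → ℝ) (hf : IntegrableOn f (Ioo a b)) {x : ℝ} (hx : x ∈ Ioo a b) :
    IntegrableOn (fun y => (c * (y - a) ^ (α - 1) +
          (1 / Gamma α) * ∫ t in Ioo a y, f t * (y - t) ^ (α - 1)) * (x - y) ^ (-α)) (Ioo a x) ∧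
    (1 / Gamma (1 - α)) * ∫ y in Ioo a x, (c * (y - a) ^ (α - 1) +
          (1 / Gamma α) * ∫ t in Ioo a y, f t * (y - t) ^ (α - 1)) * (x - y) ^ (-α) =
      c * Gamma α + ∫ y in Ioo a x, f y := by
  have hfx : IntegrableOn f (Ioo a x) := hf.mono_set (Ioo_subset_Ioo_right hx.2.le)
  have i1 := (beta_int α a x h0 h1 hx.1).const_mul c
  have i2 := (frac_int' α a x f h0 h1 hfx).const_mul (1 / Gamma α)
  have e : (fun y => (c * (y - a) ^ (α - 1) +
          (1 / Gamma α) * ∫ t in Ioo a y, f t * (y - t) ^ (α - 1)) * (x - y) ^ (-α)) =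
      fun y => c * ((y - a) ^ (α - 1) * (x - y) ^ (-α)) +
        (1 / Gamma α) * ((∫ t in Ioo a y, f t * (y - t) ^ (α - 1)) * (x - y) ^ (-α)) := by
    ext y; ring
  rw [e]
  refine ⟨i1.add i2, ?_⟩
  rw [integral_add i1 i2, integral_const_mul, integral_const_mul, beta_aux α a x h0 h1 hx.1,
    semi α a x f h0 h1 hfx]
  have := (Gamma_pos_of_pos h0).ne'
  have := (Gamma_pos_of_pos (sub_pos.2 h1)).ne'
  field_simp

theorem stmt_2 (α a b : ℝ) (hα₀ : 0 < α) (hα₁ : α < 1) (hab : a < b)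
    (f F : ℝ → ℝ) (hf : IntegrableOn f (Set.Ioo a b)) (hF : IntegrableOn F (Set.Ioo a b)) :
    (∃ c : ℝ, ∀ᵐ x : ℝ, x ∈ Set.Ioo a b →
        (1 / Real.Gamma (1 - α)) * ∫ y in Set.Ioo a x, F y * (x - y) ^ (-α) =
          c + ∫ y in Set.Ioo a x, f y) ↔
    (∃ c' : ℝ, ∀ᵐ x : ℝ, x ∈ Set.Ioo a b →
        F x = c' * (x - a) ^ (α - 1) +
          (1 / Real.Gamma α) * ∫ y in Set.Ioo a x, f y * (x - y) ^ (α - 1)) := by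
  have gα := (Gamma_pos_of_pos hα₀).ne'
  have gα' := (Gamma_pos_of_pos (sub_pos.2 hα₁)).ne'
  constructor
  · rintro ⟨c, hc⟩
    refine ⟨c / Gamma α, ?_⟩
    set G : ℝ → ℝ := fun x => c / Gamma α * (x - a) ^ (α - 1) +
          (1 / Gamma α) * ∫ y in Ioo a x, f y * (x - y) ^ (α - 1) with hG
    have hGi : IntegrableOn G (Ioo a b) :=
      ((pow_int α a b hα₀).const_mul _).add ((frac_int α a b f hα₀ hα₁ hf).const_mul _)
    have hD : IntegrableOn (fun x => F x - G x) (Ioo a b) := hF.sub hGi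
    have hzero : ∀ᵐ z : ℝ, z ∈ Ioo a b →
        ∫ y in Ioo a z, (F y - G y) * (z - y) ^ ((1 - α) - 1) = 0 := by
      filter_upwards [hc, ker_int (1 - α) a b F (by linarith) (by linarith) hF] with z hz hzi hm
      obtain ⟨r1, r2⟩ := frac_rhs α a b (c / Gamma α) hα₀ hα₁ f hf hm
      have hz := hz hm
      have hzi := hzi hm
      rw [show 1 - α - 1 = -α by ring] at hzi ⊢
      rw [div_mul_cancel₀ _ gα, ← hz] at r2
      have r3 := mul_left_cancel₀ (one_div_ne_zero gα') r2
      simp_rw [sub_mul]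
      rw [integral_sub hzi r1, r3, sub_self]
    have := ae_zero a b (fun x => F x - G x) hD ?_
    · filter_upwards [this] with x hx hm
      linarith [hx hm]
    · refine ae_of_all _ fun x hx => ?_
      have hs := semi (1 - α) a x (fun x => F x - G x) (by linarith) (by linarith)
        (hD.mono_set (Ioo_subset_Ioo_right hx.2.le))
      have h0 : ∫ z in Ioo a x, (∫ y in Ioo a z, (F y - G y) * (z - y) ^ ((1 - α) - 1)) *
          (x - z) ^ (-(1 - α)) = 0 := by
        rw [← integral_zero ℝ ℝ (μ := volume.restrict (Ioo a x))]
        refine setIntegral_congr_ae measurableSet_Ioo ?_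
        filter_upwards [hzero] with z hz hm
        rw [hz ⟨hm.1, hm.2.trans hx.2⟩, zero_mul]
      rw [h0, sub_sub_cancel] at hs
      exact (mul_eq_zero.1 hs.symm).resolve_left (mul_ne_zero gα' gα)
  · rintro ⟨c, hc⟩
    refine ⟨c * Gamma α, ae_of_all _ fun x hx => ?_⟩
    rw [← (frac_rhs α a b c hα₀ hα₁ f hf hx).2]
    congr 1
    refine setIntegral_congr_ae measurableSet_Ioo ?_
    filter_upwards [hc] with y hy hm
    rw [hy ⟨hm.1, hm.2.trans hx.2⟩]
end

section
/- Let 0 < α < β < 1, let a < b be real, let c ∈ ℝ and g ∈ L¹((a,b)), and define f(x) = c·(x−a)^{β−1} + (1/Γ(β)) ∫_a^x g(y)(x−y)^{β−1} dy. Then: f ∈ L¹((a,b)); the function h(x) := c·(Γ(β)/Γ(β−α))·(x−a)^{β−α−1} + (1/Γ(β−α)) ∫_a^x g(y)(x−y)^{β−α−1} dy belongs to L¹((a,b)); and there exists c₂ ∈ ℝ such that (1/Γ(1−α)) ∫_a^x f(y)(x−y)^{−α} dy = c₂ + ∫_a^x h(y) dy for almost every x ∈ (a,b). In other words, if the left Riemann–Liouville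 derivative of order β of f exists in L¹((a,b)), then so does the left Riemann–Liouville derivative of order α, and it equals h. -/
open MeasureTheory Real Set
open scoped ENNReal

/-- The scaled and translated real beta integral. -/
lemma beta_shift (p q : ℝ) (hp : 0 < p) (hq : 0 < q) (t x : ℝ) (htx : t < x) :
    ∫ y in Ioo t x, (y - t) ^ (p - 1) * (x - y) ^ (q - 1) =
      Gamma p * Gamma q / Gamma (p + q) * (x - t) ^ (p + q - 1) := by
  have h0 : 0 < x - t := sub_pos.2 htx
  rw [← integral_Ioc_eq_integral_Ioo, ← intervalIntegral.integral_of_le htx.le]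
  have h1 : ∫ y in t..x, (y - t) ^ (p - 1) * (x - y) ^ (q - 1) =
      ∫ y in (0:ℝ)..(x - t), y ^ (p - 1) * ((x - t) - y) ^ (q - 1) := by
    have := intervalIntegral.integral_comp_sub_right (a := t) (b := x)
      (fun y : ℝ => y ^ (p - 1) * ((x - t) - y) ^ (q - 1)) t
    simpa using this
  rw [h1]
  have h2 := Complex.betaIntegral_scaled p q h0
  rw [Complex.betaIntegral_eq_Gamma_mul_div _ _ (by simpa) (by simpa)] at h2
  have h3 : ∫ y in (0:ℝ)..(x - t), (y:ℂ) ^ ((p:ℂ) - 1) * (((x - t : ℝ) : ℂ) - y) ^ ((q:ℂ) - 1) =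
      ∫ y in (0:ℝ)..(x - t), ((y ^ (p - 1) * ((x - t) - y) ^ (q - 1) : ℝ) : ℂ) := by
    apply intervalIntegral.integral_congr
    intro y hy
    rw [uIcc_of_le h0.le] at hy
    simp only
    rw [Complex.ofReal_mul, Complex.ofReal_cpow hy.1, Complex.ofReal_cpow (sub_nonneg.2 hy.2)]
    push_cast
    rfl
  rw [h3, intervalIntegral.integral_ofReal] at h2
  apply Complex.ofReal_injective
  rw [h2, Complex.ofReal_mul, Complex.ofReal_cpow h0.le]
  simp only [Complex.Gamma_ofReal, ← Complex.ofReal_add]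
  push_cast
  simp only [← Complex.Gamma_ofReal]
  push_cast
  ring

lemma beta_shift_int (p q : ℝ) (hp : 0 < p) (hq : 0 < q) (t x : ℝ) (htx : t < x) :
    IntegrableOn (fun y => (y - t) ^ (p - 1) * (x - y) ^ (q - 1)) (Ioo t x) := by
  by_contra hn
  have h1 := beta_shift p q hp hq t x htx
  rw [integral_undef hn] at h1
  have h0 : 0 < x - t := sub_pos.2 htx
  have := Gamma_pos_of_pos hp
  have := Gamma_pos_of_pos hq
  have := Gamma_pos_of_pos (add_pos hp hq)
  have : 0 < Gamma p * Gamma q / Gamma (p + q) * (x - t) ^ (p + q - 1) := by positivity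
  linarith

/-- The kernel on the triangle. -/
noncomputable def kerF (g : ℝ → ℝ) (p q x : ℝ) (z : ℝ × ℝ) : ℝ :=
  g z.2 * (Ioo z.2 x).indicator (fun y => (y - z.2) ^ (p - 1) * (x - y) ^ (q - 1)) z.1

lemma kerF_slice (g : ℝ → ℝ) (p q : ℝ) (hp : 0 < p) (hq : 0 < q) (a x t : ℝ) (ht : t ∈ Ioo a x) :
    ∫ y in Ioo a x, kerF g p q x (y, t) =
      g t * (Gamma p * Gamma q / Gamma (p + q) * (x - t) ^ (p + q - 1)) := by
  simp only [kerF]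
  rw [integral_const_mul, setIntegral_indicator measurableSet_Ioo,
    inter_eq_right.2 (Ioo_subset_Ioo_left ht.1.le), beta_shift p q hp hq t x ht.2]

lemma kerF_abs (g : ℝ → ℝ) (p q x : ℝ) (z : ℝ × ℝ) :
    ‖kerF g p q x z‖ = kerF (fun t => |g t|) p q x z := by
  simp only [kerF, norm_mul, Real.norm_eq_abs]
  congr 1
  apply abs_of_nonneg
  apply indicator_nonneg
  intro y hy
  have := sub_pos.2 hy.1
  have := sub_pos.2 hy.2
  positivity

lemma pow_int_s3 (g : ℝ → ℝ) (r a x : ℝ) (hr : 0 ≤ r)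
    (hg : IntegrableOn g (Ioo a x)) : IntegrableOn (fun t => g t * (x - t) ^ r) (Ioo a x) := by
  refine Integrable.mul_bdd (c := (x - a) ^ r) hg ?_ ?_
  · exact (by fun_prop : Measurable fun t : ℝ => (x - t) ^ r).aestronglyMeasurable
  · filter_upwards [ae_restrict_mem measurableSet_Ioo] with t ht
    have := sub_pos.2 ht.2
    rw [Real.norm_of_nonneg (by positivity)]
    apply rpow_le_rpow this.le _ hr
    linarith [ht.1]

lemma kerF_integrable (g : ℝ → ℝ) (p q : ℝ) (hp : 0 < p) (hq : 0 < q) (hpq : 1 ≤ p + q)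
    (a x : ℝ) (hg : IntegrableOn g (Ioo a x)) :
    Integrable (kerF g p q x) ((volume.restrict (Ioo a x)).prod (volume.restrict (Ioo a x))) := by
  have hm : AEStronglyMeasurable (kerF g p q x)
      ((volume.restrict (Ioo a x)).prod (volume.restrict (Ioo a x))) := by
    unfold kerF
    apply AEStronglyMeasurable.mul
    · exact hg.aestronglyMeasurable.comp_snd
    · apply Measurable.aestronglyMeasurable
      have : (fun z : ℝ × ℝ => (Ioo z.2 x).indicator
          (fun y => (y - z.2) ^ (p - 1) * (x - y) ^ (q - 1)) z.1) =
          {z : ℝ × ℝ | z.2 < z.1 ∧ z.1 < x}.indicator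
            (fun z => (z.1 - z.2) ^ (p - 1) * (x - z.1) ^ (q - 1)) := by
        ext z
        simp [indicator]
      rw [this]
      apply Measurable.indicator (by fun_prop)
      exact (measurableSet_lt measurable_snd measurable_fst).inter
        (measurableSet_lt measurable_fst measurable_const)
  rw [integrable_prod_iff' hm]
  constructor
  · filter_upwards [ae_restrict_mem measurableSet_Ioo] with t ht
    simp only [kerF]
    apply Integrable.const_mul
    rw [integrable_indicator_iff measurableSet_Ioo]
    unfold IntegrableOn
    rw [Measure.restrict_restrict measurableSet_Ioo,
      inter_eq_left.2 (Ioo_subset_Ioo_left ht.1.le)]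
    exact beta_shift_int p q hp hq t x ht.2
  · simp only [kerF_abs]
    have h1 : IntegrableOn (fun t => |g t| * (x - t) ^ (p + q - 1)) (Ioo a x) :=
      pow_int_s3 _ _ _ _ (by linarith) hg.abs
    refine Integrable.congr (h1.const_mul (Gamma p * Gamma q / Gamma (p + q))) ?_
    filter_upwards [ae_restrict_mem measurableSet_Ioo] with t ht
    rw [kerF_slice _ p q hp hq a x t ht]
    ring

lemma kerF_slice' (g : ℝ → ℝ) (p q : ℝ) (a x y : ℝ) (hy : y ∈ Ioo a x) :
    ∫ t in Ioo a x, kerF g p q x (y, t) =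
      (∫ t in Ioo a y, g t * (y - t) ^ (p - 1)) * (x - y) ^ (q - 1) := by
  have : ∀ t, kerF g p q x (y, t) =
      (Iio y).indicator (fun t => g t * (y - t) ^ (p - 1) * (x - y) ^ (q - 1)) t := by
    intro t
    simp only [kerF, indicator, mem_Ioo, mem_Iio, hy.2, and_true]
    split_ifs <;> ring
  simp only [this]
  have h2 : Ioo a x ∩ Iio y = Ioo a y := by
    ext t
    simp only [mem_inter_iff, mem_Ioo, mem_Iio]
    have := hy.2
    constructor
    · rintro ⟨⟨_, _⟩, _⟩
      constructor <;> linarith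
    · rintro ⟨_, _⟩
      refine ⟨⟨?_, ?_⟩, ?_⟩ <;> linarith
  rw [setIntegral_indicator measurableSet_Iio, h2, integral_mul_const]

lemma semi_int (g : ℝ → ℝ) (p q : ℝ) (hp : 0 < p) (hq : 0 < q) (hpq : 1 ≤ p + q)
    (a x : ℝ) (hg : IntegrableOn g (Ioo a x)) :
    IntegrableOn (fun y => (∫ t in Ioo a y, g t * (y - t) ^ (p - 1)) * (x - y) ^ (q - 1))
      (Ioo a x) := by
  refine Integrable.congr (kerF_integrable g p q hp hq hpq a x hg).integral_prod_left ?_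
  filter_upwards [ae_restrict_mem measurableSet_Ioo] with y hy
  exact kerF_slice' g p q a x y hy

lemma semi_eq (g : ℝ → ℝ) (p q : ℝ) (hp : 0 < p) (hq : 0 < q) (hpq : 1 ≤ p + q)
    (a x : ℝ) (hg : IntegrableOn g (Ioo a x)) :
    ∫ y in Ioo a x, (∫ t in Ioo a y, g t * (y - t) ^ (p - 1)) * (x - y) ^ (q - 1) =
      Gamma p * Gamma q / Gamma (p + q) * ∫ t in Ioo a x, g t * (x - t) ^ (p + q - 1) := by
  have h := integral_integral_swap (f := fun y t => kerF g p q x (y, t))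
    (kerF_integrable g p q hp hq hpq a x hg)
  rw [setIntegral_congr_fun measurableSet_Ioo (fun y hy => kerF_slice' g p q a x y hy),
    setIntegral_congr_fun measurableSet_Ioo
      (fun t ht => kerF_slice g p q hp hq a x t ht)] at h
  rw [h, ← integral_const_mul]
  congr 1
  ext t
  ring

/-- Combined statement for `c (y-a)^(p-1) + d I g`. -/
lemma comb_int (g : ℝ → ℝ) (c d p q : ℝ) (hp : 0 < p) (hq : 0 < q) (hpq : 1 ≤ p + q)
    (a x : ℝ) (hax : a < x) (hg : IntegrableOn g (Ioo a x)) :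
    IntegrableOn (fun y => (c * (y - a) ^ (p - 1) +
      d * ∫ t in Ioo a y, g t * (y - t) ^ (p - 1)) * (x - y) ^ (q - 1)) (Ioo a x) := by
  refine (((beta_shift_int p q hp hq a x hax).const_mul c).add
    ((semi_int g p q hp hq hpq a x hg).const_mul d)).congr ?_
  filter_upwards with y
  simp only [Pi.add_apply]
  ring

lemma comb_eq (g : ℝ → ℝ) (c d p q : ℝ) (hp : 0 < p) (hq : 0 < q) (hpq : 1 ≤ p + q)
    (a x : ℝ) (hax : a < x) (hg : IntegrableOn g (Ioo a x)) :
    ∫ y in Ioo a x, (c * (y - a) ^ (p - 1) +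
      d * ∫ t in Ioo a y, g t * (y - t) ^ (p - 1)) * (x - y) ^ (q - 1) =
      Gamma p * Gamma q / Gamma (p + q) *
        (c * (x - a) ^ (p + q - 1) + d * ∫ t in Ioo a x, g t * (x - t) ^ (p + q - 1)) := by
  have h := integral_add ((beta_shift_int p q hp hq a x hax).const_mul c)
    ((semi_int g p q hp hq hpq a x hg).const_mul d)
  rw [integral_const_mul, integral_const_mul, beta_shift p q hp hq a x hax,
    semi_eq g p q hp hq hpq a x hg] at h
  rw [mul_add, mul_left_comm _ c, mul_left_comm _ d, ← h]
  congr 1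
  ext y
  ring

theorem stmt_3 (α β a b : ℝ) (hα₀ : 0 < α) (hαβ : α < β) (hβ₁ : β < 1) (hab : a < b)
    (c : ℝ) (g : ℝ → ℝ) (hg : IntegrableOn g (Set.Ioo a b))
    (f h : ℝ → ℝ)
    (hf : ∀ x, f x = c * (x - a) ^ (β - 1) +
        (1 / Real.Gamma β) * ∫ y in Set.Ioo a x, g y * (x - y) ^ (β - 1))
    (hh : ∀ x, h x = c * (Real.Gamma β / Real.Gamma (β - α)) * (x - a) ^ (β - α - 1) +
        (1 / Real.Gamma (β - α)) * ∫ y in Set.Ioo a x, g y * (x - y) ^ (β - α - 1)) :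
    IntegrableOn f (Set.Ioo a b) ∧ IntegrableOn h (Set.Ioo a b) ∧
      ∃ c₂ : ℝ, ∀ᵐ x : ℝ, x ∈ Set.Ioo a b →
        (1 / Real.Gamma (1 - α)) * ∫ y in Set.Ioo a x, f y * (x - y) ^ (-α) =
          c₂ + ∫ y in Set.Ioo a x, h y := by
  have hβ : 0 < β := hα₀.trans hαβ
  have hd : 0 < β - α := sub_pos.2 hαβ
  have h1 : 0 < 1 - α := by linarith
  obtain rfl : f = _ := funext hf
  obtain rfl : h = _ := funext hh
  refine ⟨?_, ?_, 0, Filter.Eventually.of_forall fun x hx => ?_⟩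
  · simpa using comb_int g c (1 / Gamma β) β 1 hβ one_pos (by linarith) a b hab hg
  · simpa using comb_int g (c * (Gamma β / Gamma (β - α))) (1 / Gamma (β - α)) (β - α) 1 hd one_pos
      (by linarith) a b hab hg
  · have hg' : IntegrableOn g (Ioo a x) := hg.mono_set (Ioo_subset_Ioo_right hx.2.le)
    have e1 := comb_eq g c (1 / Gamma β) β (1 - α) hβ h1 (by linarith) a x hx.1 hg'
    have e2 := comb_eq g (c * (Gamma β / Gamma (β - α))) (1 / Gamma (β - α)) (β - α) 1 hd one_pos
      (by linarith) a x hx.1 hg'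
    rw [show 1 - α - 1 = -α by ring, show β + (1 - α) = β - α + 1 by ring] at e1
    simp only [sub_self, rpow_zero, mul_one, Gamma_one] at e2
    rw [e1, e2, zero_add]
    have := (Gamma_pos_of_pos hβ).ne'
    have := (Gamma_pos_of_pos hd).ne'
    have := (Gamma_pos_of_pos h1).ne'
    have : Gamma (β - α + 1) ≠ 0 := (Gamma_pos_of_pos (by linarith)).ne'
    field_simp
end

section
/- Let 0 < α < 1 and let f ∈ L¹(ℝ) (Lebesgue measure). Suppose F ∈ L¹(ℝ) satisfies F(x) = (1/Γ(α)) ∫_{−∞}^x f(y) (x−y)^{α−1} dy for almost every x ∈ ℝ. Then (1/Γ(1−α)) ∫_{−∞}^x F(y) (x−y)^{−α} dy = ∫_{−∞}^x f(y) dy for almost every x ∈ ℝ; in particular I^{1−α}F is (a.e. equal to) a locally absolutely continuous function whose a.e. derivative is f, i.e. the left Liouville fractional derivative of order α of F equals f. -/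
open MeasureTheory Real Set
open scoped ENNReal

lemma aux_beta0 (α : ℝ) (hα₀ : 0 < α) (hα₁ : α < 1) (a : ℝ) (ha : 0 < a) :
    ∫ u in (0 : ℝ)..a, u ^ (α - 1) * (a - u) ^ (-α) = Real.Gamma α * Real.Gamma (1 - α) := by
  have h1 := Complex.betaIntegral_scaled (α : ℂ) ((1 - α : ℝ) : ℂ) ha
  have h2 := Complex.Gamma_mul_Gamma_eq_betaIntegral (s := (α : ℂ)) (t := ((1 - α : ℝ) : ℂ))
    (by simpa using hα₀) (by rw [Complex.ofReal_re]; linarith)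
  have e : (α : ℂ) + ((1 - α : ℝ) : ℂ) = 1 := by push_cast; ring
  rw [e, Complex.Gamma_one, one_mul, Complex.Gamma_ofReal, Complex.Gamma_ofReal] at h2
  rw [e, sub_self, Complex.cpow_zero, one_mul, ← h2] at h1
  apply Complex.ofReal_injective
  rw [Complex.ofReal_mul, ← h1, ← intervalIntegral.integral_ofReal]
  rw [intervalIntegral.integral_of_le ha.le, intervalIntegral.integral_of_le ha.le]
  refine setIntegral_congr_fun measurableSet_Ioc fun u hu => ?_
  rw [Complex.ofReal_mul, Complex.ofReal_cpow hu.1.le, Complex.ofReal_cpow (by linarith [hu.2])]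
  push_cast
  congr 2
  ring

lemma aux_beta (α : ℝ) (hα₀ : 0 < α) (hα₁ : α < 1) (z x : ℝ) (h : z < x) :
    ∫ y in Ioo z x, (y - z) ^ (α - 1) * (x - y) ^ (-α) =
      Real.Gamma α * Real.Gamma (1 - α) := by
  rw [← integral_Ioc_eq_integral_Ioo, ← intervalIntegral.integral_of_le h.le,
    ← aux_beta0 α hα₀ hα₁ (x - z) (by linarith)]
  have := intervalIntegral.integral_comp_sub_right (a := z) (b := x)
    (fun u : ℝ => u ^ (α - 1) * ((x - z) - u) ^ (-α)) z
  simp only [sub_self, sub_sub_sub_cancel_right] at this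
  exact this

theorem stmt_4 (α : ℝ) (hα₀ : 0 < α) (hα₁ : α < 1)
    (f F : ℝ → ℝ) (hf : Integrable f) (hF : Integrable F)
    (hFeq : ∀ᵐ x : ℝ, F x = (1 / Real.Gamma α) * ∫ y in Set.Iio x, f y * (x - y) ^ (α - 1)) :
    ∀ᵐ x : ℝ,
      (1 / Real.Gamma (1 - α)) * ∫ y in Set.Iio x, F y * (x - y) ^ (-α) =
        ∫ y in Set.Iio x, f y := by
  refine Filter.Eventually.of_forall fun x => ?_
  have g1 : 0 < Real.Gamma α := Real.Gamma_pos_of_pos hα₀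
  have g2 : 0 < Real.Gamma (1 - α) := Real.Gamma_pos_of_pos (by linarith)
  set C := Real.Gamma α * Real.Gamma (1 - α) with hC
  have hCpos : 0 < C := mul_pos g1 g2
  let K : ℝ × ℝ → ℝ := fun p =>
    if p.2 < p.1 ∧ p.1 < x then (p.1 - p.2) ^ (α - 1) * (x - p.1) ^ (-α) else 0
  have hKm : Measurable K := by
    refine Measurable.ite ?_ (by fun_prop) measurable_const
    exact (measurableSet_lt measurable_snd measurable_fst).inter
      (measurableSet_lt measurable_fst measurable_const)
  have hK0 : ∀ p, 0 ≤ K p := by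
    intro p
    simp only [K]
    split_ifs with h
    · exact mul_nonneg (rpow_nonneg (by linarith [h.1]) _) (rpow_nonneg (by linarith [h.2]) _)
    · exact le_rfl
  have hKi : ∀ z, (fun y => K (y, z)) =
      (Ioo z x).indicator fun y => (y - z) ^ (α - 1) * (x - y) ^ (-α) := by
    intro z
    ext y
    simp only [K, indicator, mem_Ioo]
  have hKint : ∀ z, ∫ y, K (y, z) = if z < x then C else 0 := by
    intro z
    rw [hKi, integral_indicator measurableSet_Ioo]
    split_ifs with h
    · exact aux_beta α hα₀ hα₁ z x h
    · rw [Ioo_eq_empty h]; simp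
  have hKin : ∀ z, Integrable (fun y => K (y, z)) := by
    intro z
    by_cases h : z < x
    · by_contra hn
      have := integral_undef hn
      rw [hKint, if_pos h] at this
      exact hCpos.ne' this
    · rw [hKi, Ioo_eq_empty h]; simp
  have hind : ∀ (c : ℝ) (g : ℝ → ℝ), (fun z => g z * (if z < x then c else 0)) =
      (Iio x).indicator (fun z => g z * c) := by
    intro c g
    ext z
    by_cases h : z < x <;> simp [h]
  have hint : Integrable (fun p : ℝ × ℝ => f p.2 * K p) (volume.prod volume) := by
    have hm : AEStronglyMeasurable (fun p : ℝ × ℝ => f p.2 * K p) (volume.prod volume) :=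
      hf.aestronglyMeasurable.comp_snd.mul hKm.aestronglyMeasurable
    refine (integrable_prod_iff' hm).2
      ⟨Filter.Eventually.of_forall fun z => (hKin z).const_mul (f z), ?_⟩
    have : (fun z => ∫ y, ‖f z * K (y, z)‖) = fun z => ‖f z‖ * (if z < x then C else 0) := by
      ext z
      rw [← hKint z, ← integral_const_mul]
      congr 1
      ext y
      rw [norm_mul, Real.norm_of_nonneg (hK0 _)]
    simp only [this]
    rw [hind]
    exact (hf.norm.mul_const C).indicator measurableSet_Iio
  have hswap := integral_integral_swap (f := fun y z => f z * K (y, z)) hint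
  have hR : ∫ z, ∫ y, f z * K (y, z) = C * ∫ z in Iio x, f z := by
    simp only [integral_const_mul, hKint]
    rw [hind, integral_indicator measurableSet_Iio, integral_mul_const, mul_comm]
  have hL : ∫ y, ∫ z, f z * K (y, z) =
      Real.Gamma α * ∫ y in Iio x, F y * (x - y) ^ (-α) := by
    rw [← integral_const_mul, ← integral_indicator measurableSet_Iio]
    refine integral_congr_ae ?_
    filter_upwards [hFeq] with y hy
    by_cases h : y < x
    · rw [indicator_of_mem (by exact h), hy]
      have : (fun z => f z * K (y, z)) =
          (Iio y).indicator fun z => f z * (y - z) ^ (α - 1) * (x - y) ^ (-α) := by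
        ext z
        by_cases hz : z < y <;> simp [K, hz, h, mul_assoc]
      rw [this, integral_indicator measurableSet_Iio, integral_mul_const]
      field_simp
    · rw [indicator_of_notMem (by exact h)]
      simp [K, h]
  rw [hL, hR] at hswap
  rw [hC, mul_assoc] at hswap
  rw [mul_left_cancel₀ g1.ne' hswap]
  field_simp
end

section
/- Let 0 < α < 1, let a < b be real, and let u ∈ L¹((a,b)). Suppose there exist c ∈ ℝ and g ∈ L¹((a,b)) such that (1/Γ(1−α)) ∫_a^x u(y)(x−y)^{−α} dy = c + ∫_a^x g(y) dy for almost every x ∈ (a,b) (i.e. the left Riemann–Liouville derivative of order α of u exists and equals g ∈ L¹). Then for every infinitely differentiable φ : ℝ → ℝ with compact support contained in (a,b), ∫_a^b g(x) φ(x) dx = ∫_a^b u(x) · ( −(1/Γ(1−α)) ∫_x^b φ′(y)(y−x)^{−α} dy ) dx. In other words, g is the left weak fractional derivative of order α of u. -/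
open MeasureTheory Real Set
open scoped ENNReal

theorem fubini_aux (a b : ℝ) (f w ψ : ℝ → ℝ)
    (hf : IntegrableOn f (Set.Ioo a b)) (hw : IntegrableOn w (Set.Ioo 0 (b - a)))
    (hψ : Continuous ψ) (M : ℝ) (hM : ∀ x, ‖ψ x‖ ≤ M) :
    ∫ x in Set.Ioo a b, f x * ∫ y in Set.Ioo x b, ψ y * w (y - x) =
      ∫ y in Set.Ioo a b, ψ y * ∫ x in Set.Ioo a y, f x * w (y - x) := by
  have hF : Integrable ((Ioo a b).indicator f) := hf.integrable_indicator measurableSet_Ioo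
  have hW : Integrable ((Ioo 0 (b - a)).indicator w) := hw.integrable_indicator measurableSet_Ioo
  have hI := Integrable.convolution_integrand (ContinuousLinearMap.mul ℝ ℝ) hF hW
  have hI2 : Integrable (fun p : ℝ × ℝ => (Ioo a b).indicator ψ p.1 *
      ((Ioo a b).indicator f p.2 * (Ioo 0 (b - a)).indicator w (p.1 - p.2)))
      (volume.prod volume) := by
    refine Integrable.bdd_mul (c := M) hI ?_ ?_
    · exact ((hψ.measurable.indicator measurableSet_Ioo).comp measurable_fst).aestronglyMeasurable
    · refine Filter.Eventually.of_forall fun p => ?_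
      exact (norm_indicator_le_norm_self _ _).trans (hM _)
  have hs := integral_integral_swap (f := fun y x => (Ioo a b).indicator ψ y *
      ((Ioo a b).indicator f x * (Ioo 0 (b - a)).indicator w (y - x))) hI2
  rw [← integral_indicator measurableSet_Ioo, ← integral_indicator measurableSet_Ioo]
  symm
  convert hs using 1
  · congr 1
    ext y
    by_cases hy : y ∈ Ioo a b
    · rw [indicator_of_mem hy, ← integral_indicator measurableSet_Ioo, ← integral_const_mul]
      congr 1
      ext x
      simp only [indicator, mem_Ioo] at hy ⊢
      split_ifs <;> first | rfl | (exfalso; grind) | simp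
    · simp [indicator_of_notMem hy]
  · congr 1
    ext x
    by_cases hy : x ∈ Ioo a b
    · rw [indicator_of_mem hy, ← integral_indicator measurableSet_Ioo, ← integral_const_mul]
      congr 1
      ext y
      simp only [indicator, mem_Ioo] at hy ⊢
      split_ifs <;> first | ring1 | (exfalso; grind) | simp
    · simp [indicator_of_notMem hy]

theorem stmt_5 (α a b : ℝ) (hα₀ : 0 < α) (hα₁ : α < 1) (hab : a < b)
    (u g : ℝ → ℝ) (hu : IntegrableOn u (Set.Ioo a b)) (hgI : IntegrableOn g (Set.Ioo a b))
    (c : ℝ)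
    (hRL : ∀ᵐ x : ℝ, x ∈ Set.Ioo a b →
        (1 / Real.Gamma (1 - α)) * ∫ y in Set.Ioo a x, u y * (x - y) ^ (-α) =
          c + ∫ y in Set.Ioo a x, g y) :
    ∀ φ : ℝ → ℝ, ContDiff ℝ (⊤ : ℕ∞) φ → tsupport φ ⊆ Set.Ioo a b →
      ∫ x in Set.Ioo a b, g x * φ x =
        ∫ x in Set.Ioo a b, u x *
          (-(1 / Real.Gamma (1 - α)) * ∫ y in Set.Ioo x b, deriv φ y * (y - x) ^ (-α)) := by
  intro φ hφ hsupp
  have hcs : HasCompactSupport φ :=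
    isCompact_Icc.of_isClosed_subset (isClosed_tsupport φ) (hsupp.trans Ioo_subset_Icc_self)
  have hd : Continuous (deriv φ) := hφ.continuous_deriv (by simp)
  have hdiff : Differentiable ℝ φ := hφ.differentiable (by simp)
  obtain ⟨M, hM⟩ := hcs.deriv.exists_bound_of_continuous hd
  have hφa : φ a = 0 := image_eq_zero_of_notMem_tsupport fun h => by simpa using hsupp h
  have hφb : φ b = 0 := image_eq_zero_of_notMem_tsupport fun h => by simpa using hsupp h
  have hftc : ∀ x ≤ b, ∫ y in Ioo x b, deriv φ y = - φ x := by
    intro x hx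
    rw [← integral_Ioc_eq_integral_Ioo, ← intervalIntegral.integral_of_le hx,
      intervalIntegral.integral_deriv_eq_sub (fun y _ => hdiff y) (hd.intervalIntegrable _ _), hφb]
    simp
  have hw : IntegrableOn (fun t : ℝ => t ^ (-α)) (Ioo 0 (b - a)) := by
    have := intervalIntegral.intervalIntegrable_rpow' (a := 0) (b := b - a) (r := -α) (by linarith)
    rw [intervalIntegrable_iff_integrableOn_Ioo_of_le (by linarith)] at this
    exact this
  have h1 := fubini_aux a b u (fun t => t ^ (-α)) (deriv φ) hu hw hd M hM
  have h2 := fubini_aux a b g (fun t => 1) (deriv φ) hgI (by simp) hd M hM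
  simp only [mul_one] at h2
  set K := 1 / Real.Gamma (1 - α)
  have hprim : IntegrableOn (fun y => deriv φ y * ∫ x in Ioo a y, g x) (Ioo a b) := by
    have hc : ContinuousOn (fun y => ∫ x in Ioc a y, g x) (Icc a b) :=
      intervalIntegral.continuousOn_primitive
        ((integrableOn_Icc_iff_integrableOn_Ioo).2 hgI)
    have := (hd.continuousOn.mul hc).integrableOn_Icc (μ := volume)
    simp only [integral_Ioc_eq_integral_Ioo] at this
    exact this.mono_set Ioo_subset_Icc_self
  have hdi : IntegrableOn (fun y => deriv φ y * c) (Ioo a b) :=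
    ((hd.mul continuous_const).continuousOn.integrableOn_Icc (a := a) (b := b)).mono_set
      Ioo_subset_Icc_self
  have h3 : K * ∫ y in Ioo a b, deriv φ y * ∫ x in Ioo a y, u x * (y - x) ^ (-α) =
      - ∫ x in Ioo a b, g x * φ x := by
    rw [← integral_const_mul]
    have : ∫ y in Ioo a b, K * (deriv φ y * ∫ x in Ioo a y, u x * (y - x) ^ (-α)) =
        ∫ y in Ioo a b, (deriv φ y * c + deriv φ y * ∫ x in Ioo a y, g x) := by
      refine setIntegral_congr_ae measurableSet_Ioo ?_
      filter_upwards [hRL] with y hy hm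
      rw [← mul_add, ← hy hm]
      ring
    rw [this, integral_add hdi hprim, ← h2, integral_mul_const, hftc a hab.le, hφa,
      ← integral_neg]
    simp only [neg_zero, zero_mul, zero_add]
    refine setIntegral_congr_fun measurableSet_Ioo fun x hx => ?_
    simp only [hftc x hx.2.le]
    ring
  rw [← h1, ← integral_const_mul] at h3
  rw [← neg_eq_iff_eq_neg.2 h3, ← integral_neg]
  refine setIntegral_congr_fun measurableSet_Ioo fun x hx => ?_
  ring
end

section
/- Let 0 < α < 1, let u ∈ L¹(ℝ), and let v be locally integrable on ℝ. Then the following are equivalent: (i) ∫_ℝ v(x)φ(x) dx = ∫_ℝ u(x)·( −(1/Γ(1−α)) ∫_x^∞ φ′(y)(y−x)^{−α} dy ) dx for every infinitely differentiable compactly supported φ : ℝ → ℝ (i.e. v is the left weak fractional derivative of order α of u); (ii) there exists a sequence (u_j) of infinitely differentiable compactly supported functions on ℝ such that ∫_ℝ |u_j − u| dx → 0 and, for every compact set K ⊂ ℝ, ∫_K |D₋^α u_j − v| dx → 0 as j → ∞, where (D₋^α u_j)(x) = (1/Γ(1−α)) ∫_{−∞}^x u_j′(y)(x−y)^{−α}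 dy. -/
open MeasureTheory Real Set Filter
open scoped ENNReal Topology

/-- the kernel `t₊^{-α}` -/
noncomputable def fkern (α : ℝ) : ℝ → ℝ := (Ioi (0:ℝ)).indicator fun t => t ^ (-α)

lemma fkern_nonneg (α t : ℝ) : 0 ≤ fkern α t := by
  unfold fkern
  apply indicator_nonneg
  intro t ht
  exact Real.rpow_nonneg (le_of_lt ht) _

lemma fkern_meas (α : ℝ) : Measurable (fkern α) := by
  unfold fkern
  exact (measurable_id.pow_const _).indicator measurableSet_Ioi

lemma fkern_le {α : ℝ} (h0 : 0 < α) {r t : ℝ} (hr : 0 < r) (h : r ≤ t) : fkern α t ≤ r ^ (-α) := by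
  unfold fkern
  rw [indicator_of_mem (show t ∈ Ioi (0:ℝ) from lt_of_lt_of_le hr h)]
  exact Real.rpow_le_rpow_of_nonpos hr h (by linarith)

/-- truncated kernel -/
noncomputable def fkern1 (α : ℝ) : ℝ → ℝ := (Ioc (0:ℝ) 1).indicator fun t => t ^ (-α)

lemma fkern1_int {α : ℝ} (h1 : α < 1) : Integrable (fkern1 α) := by
  unfold fkern1
  rw [integrable_indicator_iff measurableSet_Ioc]
  have := intervalIntegral.intervalIntegrable_rpow' (a := 0) (b := 1) (r := -α) (by linarith)
  rwa [intervalIntegrable_iff_integrableOn_Ioc_of_le zero_le_one] at this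

lemma fkern_le1 {α : ℝ} (h0 : 0 < α) (t : ℝ) : fkern α t ≤ fkern1 α t + 1 := by
  by_cases ht : t ∈ Ioc (0:ℝ) 1
  · have h : fkern1 α t = fkern α t := by
      unfold fkern fkern1
      rw [indicator_of_mem ht, indicator_of_mem (show t ∈ Ioi (0:ℝ) from ht.1)]
    linarith
  · have h : fkern1 α t = 0 := by
      unfold fkern1; rw [indicator_of_notMem ht]
    rw [h]
    by_cases h2 : 0 < t
    · have h3 : 1 ≤ t := by
        by_contra h3
        exact ht ⟨h2, by linarith⟩
      have := fkern_le h0 one_pos h3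
      simpa using this
    · have : fkern α t = 0 := by
        unfold fkern; rw [indicator_of_notMem (show t ∉ Ioi (0:ℝ) from h2)]
      rw [this]; norm_num

lemma fkern1_nonneg (α t : ℝ) : 0 ≤ fkern1 α t := by
  unfold fkern1
  apply indicator_nonneg
  intro t ht
  exact Real.rpow_nonneg (le_of_lt ht.1) _

lemma kern_bound {α : ℝ} (h0 : 0 < α) (h1 : α < 1) {h : ℝ → ℝ} (hm : AEStronglyMeasurable h)
    (hi : Integrable h) {M : ℝ} (hM : ∀ t, |h t| ≤ M) :
    Integrable (fun t => h t * fkern α t) ∧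
    ∫ t, |h t * fkern α t| ≤ M * (∫ t, fkern1 α t) + ∫ t, |h t| := by
  have hdom : Integrable (fun t => M * fkern1 α t + |h t|) :=
    ((fkern1_int h1).const_mul M).add hi.abs
  have hb : ∀ t, |h t * fkern α t| ≤ M * fkern1 α t + |h t| := by
    intro t
    rw [abs_mul, abs_of_nonneg (fkern_nonneg α t)]
    calc |h t| * fkern α t ≤ |h t| * (fkern1 α t + 1) := by
          gcongr; exact fkern_le1 h0 t
      _ = |h t| * fkern1 α t + |h t| := by ring
      _ ≤ _ := by
          gcongr
          · exact fkern1_nonneg α t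
          · exact hM t
  have hI : Integrable (fun t => h t * fkern α t) :=
    hdom.mono' (hm.mul (fkern_meas α).aestronglyMeasurable) (Eventually.of_forall hb)
  refine ⟨hI, ?_⟩
  calc _ ≤ ∫ t, (M * fkern1 α t + |h t|) := integral_mono hI.abs hdom hb
    _ = _ := by
      rw [integral_add ((fkern1_int h1).const_mul M) hi.abs, integral_const_mul]

/-- good functions -/
structure Good (g : ℝ → ℝ) : Prop where
  cont : Continuous g
  int : Integrable g
  bdd : ∃ M, ∀ t, |g t| ≤ M

lemma good_of_cs {g : ℝ → ℝ} (hc : Continuous g) (hs : HasCompactSupport g) : Good g := by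
  refine ⟨hc, hc.integrable_of_hasCompactSupport hs, ?_⟩
  exact hc.bounded_above_of_compact_support hs

lemma good_add {α : ℝ} (h0 : 0 < α) (h1 : α < 1) {g : ℝ → ℝ} (hg : Good g) :
    ∃ C, ∀ x, Integrable (fun t => g (x + t) * fkern α t) ∧ ∫ t, |g (x + t) * fkern α t| ≤ C := by
  obtain ⟨M, hM⟩ := hg.bdd
  refine ⟨M * (∫ t, fkern1 α t) + ∫ t, |g t|, fun x => ?_⟩
  have := kern_bound h0 h1 (h := fun t => g (x + t)) (by
    exact (hg.cont.comp (by fun_prop)).aestronglyMeasurable) (hg.int.comp_add_left x)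
    (M := M) (fun t => hM _)
  rwa [integral_add_left_eq_self (fun t => |g t|) x] at this

lemma good_sub {α : ℝ} (h0 : 0 < α) (h1 : α < 1) {g : ℝ → ℝ} (hg : Good g) :
    ∃ C, ∀ x, Integrable (fun t => g (x - t) * fkern α t) ∧ ∫ t, |g (x - t) * fkern α t| ≤ C := by
  obtain ⟨M, hM⟩ := hg.bdd
  refine ⟨M * (∫ t, fkern1 α t) + ∫ t, |g t|, fun x => ?_⟩
  have := kern_bound h0 h1 (h := fun t => g (x - t)) (by
    exact (hg.cont.comp (by fun_prop)).aestronglyMeasurable) (hg.int.comp_sub_left x)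
    (M := M) (fun t => hM _)
  rwa [integral_sub_left_eq_self (fun t => |g t|) volume x] at this

lemma kern_meas2 {α : ℝ} {H : ℝ × ℝ → ℝ} (hH : Continuous H) :
    Measurable (fun p : ℝ × ℝ => H p * fkern α p.2) :=
  hH.measurable.mul ((fkern_meas α).comp measurable_snd)

lemma kern_fubini {α : ℝ} {f : ℝ → ℝ} (hf : Integrable f) {H : ℝ × ℝ → ℝ} (hH : Continuous H)
    {C : ℝ} (hC : ∀ x, Integrable (fun t => H (x, t) * fkern α t) ∧
      ∫ t, |H (x, t) * fkern α t| ≤ C) :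
    Integrable (fun p : ℝ × ℝ => f p.1 * (H p * fkern α p.2)) (volume.prod volume) := by
  have hm : AEStronglyMeasurable (fun p : ℝ × ℝ => f p.1 * (H p * fkern α p.2))
      (volume.prod volume) :=
    hf.aestronglyMeasurable.comp_fst.mul (kern_meas2 hH).aestronglyMeasurable
  rw [integrable_prod_iff hm]
  refine ⟨Eventually.of_forall fun x => (hC x).1.const_mul (f x), ?_⟩
  refine (hf.abs.mul_const C).mono' hm.norm.integral_prod_right' (Eventually.of_forall fun x => ?_)
  have h1 : ∫ t, ‖f x * (H (x, t) * fkern α t)‖ = |f x| * ∫ t, |H (x, t) * fkern α t| := by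
    rw [← integral_const_mul]
    simp [abs_mul]
  simp only [h1]
  rw [Real.norm_of_nonneg (by positivity)]
  gcongr
  exact (hC x).2

lemma right_eq (α : ℝ) (f : ℝ → ℝ) (x : ℝ) :
    ∫ y in Ioi x, f y * (y - x) ^ (-α) = ∫ t, f (x + t) * fkern α t := by
  rw [← integral_indicator measurableSet_Ioi, ← integral_add_left_eq_self _ x]
  congr 1
  ext t
  unfold fkern
  by_cases ht : 0 < t
  · rw [indicator_of_mem (show x + t ∈ Ioi x by simpa using ht),
      indicator_of_mem (show t ∈ Ioi (0:ℝ) from ht)]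
    simp
  · rw [indicator_of_notMem (show x + t ∉ Ioi x by simpa using ht),
      indicator_of_notMem (show t ∉ Ioi (0:ℝ) from ht)]
    simp

lemma left_eq (α : ℝ) (f : ℝ → ℝ) (x : ℝ) :
    ∫ y in Iio x, f y * (x - y) ^ (-α) = ∫ t, f (x - t) * fkern α t := by
  rw [← integral_indicator measurableSet_Iio, ← integral_sub_left_eq_self _ volume x]
  congr 1
  ext t
  unfold fkern
  by_cases ht : 0 < t
  · rw [indicator_of_mem (show x - t ∈ Iio x by simpa using ht),
      indicator_of_mem (show t ∈ Ioi (0:ℝ) from ht)]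
    simp
  · rw [indicator_of_notMem (show x - t ∉ Iio x by simpa using ht),
      indicator_of_notMem (show t ∉ Ioi (0:ℝ) from ht)]
    simp

lemma by_parts {α : ℝ} (h0 : 0 < α) (h1 : α < 1) {φ U : ℝ → ℝ}
    (hφ : ContDiff ℝ (⊤ : ℕ∞) φ) (hφs : HasCompactSupport φ)
    (hU : ContDiff ℝ (⊤ : ℕ∞) U) (hUs : HasCompactSupport U) :
    ∫ x, φ x * ∫ t, deriv U (x - t) * fkern α t =
      ∫ x, U x * -∫ t, deriv φ (x + t) * fkern α t := by
  have dφ : Continuous (deriv φ) := hφ.continuous_deriv (by simp)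
  have dU : Continuous (deriv U) := hU.continuous_deriv (by simp)
  obtain ⟨C1, hC1⟩ := good_sub h0 h1 (good_of_cs dU hUs.deriv)
  obtain ⟨C2, hC2⟩ := good_add h0 h1 (good_of_cs dφ hφs.deriv)
  have I1 := kern_fubini (α := α) (hφ.continuous.integrable_of_hasCompactSupport hφs)
    (H := fun p => deriv U (p.1 - p.2)) (by fun_prop) hC1
  have I2 := kern_fubini (α := α) (hU.continuous.integrable_of_hasCompactSupport hUs)
    (H := fun p => deriv φ (p.1 + p.2)) (by fun_prop) hC2
  simp_rw [mul_neg, integral_neg, ← integral_const_mul]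
  rw [integral_integral_swap (f := fun x t => φ x * (deriv U (x - t) * fkern α t)) I1,
    integral_integral_swap (f := fun x t => U x * (deriv φ (x + t) * fkern α t)) I2, ← integral_neg]
  congr 1
  ext t
  simp only [← mul_assoc]
  rw [integral_mul_const, integral_mul_const, ← neg_mul]
  congr 1
  have e : ∫ x, U x * deriv φ (x + t) = ∫ x, deriv φ x * U (x - t) := by
    rw [← integral_sub_right_eq_self _ t]
    congr 1; ext x; simp [mul_comm]
  rw [e]
  have hUt : Continuous (fun x => U (x - t)) := hU.continuous.comp (by fun_prop)
  have hdUt : Continuous (fun x => deriv U (x - t)) := dU.comp (by fun_prop)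
  apply integral_mul_deriv_eq_deriv_mul_of_integrable (u := φ) (u' := deriv φ)
    (v := fun x => U (x - t)) (v' := fun x => deriv U (x - t))
  · intro x _
    exact (hφ.differentiable (by simp) x).hasDerivAt
  · intro x _
    exact ((hU.differentiable (by simp) (x - t)).hasDerivAt).comp_sub_const x t
  · exact (hφ.continuous.mul hdUt).integrable_of_hasCompactSupport hφs.mul_right
  · exact (dφ.mul hUt).integrable_of_hasCompactSupport hφs.deriv.mul_right
  · exact (hφ.continuous.mul hUt).integrable_of_hasCompactSupport hφs.mul_right

lemma left_meas {α : ℝ} {g : ℝ → ℝ} (hg : Continuous g) :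
    AEStronglyMeasurable (fun x => ∫ t, g (x - t) * fkern α t) :=
  (kern_meas2 (α := α) (H := fun p : ℝ × ℝ => g (p.1 - p.2))
    (by fun_prop)).aestronglyMeasurable.integral_prod_right' (μ := volume) (ν := volume)

lemma right_meas {α : ℝ} {g : ℝ → ℝ} (hg : Continuous g) :
    AEStronglyMeasurable (fun x => ∫ t, g (x + t) * fkern α t) :=
  (kern_meas2 (α := α) (H := fun p : ℝ × ℝ => g (p.1 + p.2))
    (by fun_prop)).aestronglyMeasurable.integral_prod_right' (μ := volume) (ν := volume)

lemma left_intOn {α : ℝ} (h0 : 0 < α) (h1 : α < 1) {g : ℝ → ℝ} (hg : Good g) {K : Set ℝ}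
    (hK : IsCompact K) : IntegrableOn (fun x => ∫ t, g (x - t) * fkern α t) K := by
  obtain ⟨C, hC⟩ := good_sub h0 h1 hg
  refine Measure.integrableOn_of_bounded (M := C) hK.measure_lt_top.ne (left_meas hg.cont)
    (Eventually.of_forall fun x => ?_)
  exact (norm_integral_le_integral_norm _).trans (hC x).2

lemma backward {α : ℝ} (h0 : 0 < α) (h1 : α < 1) (c : ℝ)
    {u v : ℝ → ℝ} (hu : Integrable u) (hv : LocallyIntegrable v) {U : ℕ → ℝ → ℝ}
    (hU : ∀ j, ContDiff ℝ (⊤ : ℕ∞) (U j) ∧ HasCompactSupport (U j))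
    (hL : Tendsto (fun j => ∫ x, |U j x - u x|) atTop (𝓝 0))
    (hK : ∀ K : Set ℝ, IsCompact K → Tendsto (fun j => ∫ x in K,
      |c * (∫ t, deriv (U j) (x - t) * fkern α t) - v x|) atTop (𝓝 0))
    {φ : ℝ → ℝ} (hφ : ContDiff ℝ (⊤ : ℕ∞) φ) (hφs : HasCompactSupport φ) :
    ∫ x, v x * φ x = ∫ x, u x * (-c * ∫ t, deriv φ (x + t) * fkern α t) := by
  have dφ : Continuous (deriv φ) := hφ.continuous_deriv (by simp)
  obtain ⟨C2, hC2⟩ := good_add h0 h1 (good_of_cs dφ hφs.deriv)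
  obtain ⟨M, hM⟩ := hφ.continuous.bounded_above_of_compact_support hφs
  set P : ℝ → ℝ := fun x => -c * ∫ t, deriv φ (x + t) * fkern α t with hP
  have hPm : AEStronglyMeasurable P := (right_meas dφ).const_mul _
  have hPb : ∀ x, ‖P x‖ ≤ |c| * C2 := by
    intro x
    simp only [hP, norm_mul, norm_neg, Real.norm_eq_abs]
    gcongr
    exact (abs_integral_le_integral_abs).trans (hC2 x).2
  have hUi : ∀ j, Integrable (U j) := fun j =>
    (hU j).1.continuous.integrable_of_hasCompactSupport (hU j).2
  -- right side convergence
  have R : Tendsto (fun j => ∫ x, U j x * P x) atTop (𝓝 (∫ x, u x * P x)) := by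
    rw [tendsto_iff_norm_sub_tendsto_zero]
    have hL' := hL.mul_const (|c| * C2)
    rw [zero_mul] at hL'
    refine squeeze_zero (fun _ => norm_nonneg _) (fun j => ?_) hL'
    rw [← integral_sub ((hUi j).mul_bdd hPm (Eventually.of_forall hPb))
      (hu.mul_bdd hPm (Eventually.of_forall hPb)), ← integral_mul_const]
    refine norm_integral_le_of_norm_le (((hUi j).sub hu).abs.mul_const _)
      (Eventually.of_forall fun x => ?_)
    rw [← sub_mul, norm_mul]
    exact mul_le_mul_of_nonneg_left (hPb x) (norm_nonneg _)
  have hKc : IsCompact (tsupport φ) := hφs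
  have E : ∀ j, ∫ x, U j x * P x =
      ∫ x in tsupport φ, (c * ∫ t, deriv (U j) (x - t) * fkern α t) * φ x := by
    intro j
    have h := by_parts h0 h1 hφ hφs (hU j).1 (hU j).2
    rw [setIntegral_eq_integral_of_forall_compl_eq_zero
      (fun x hx => by rw [image_eq_zero_of_notMem_tsupport hx, mul_zero])]
    calc _ = c * ∫ x, U j x * -∫ t, deriv φ (x + t) * fkern α t := by
          rw [← integral_const_mul]; congr 1; ext x; simp only [hP]; ring
      _ = _ := by
          rw [← h, ← integral_const_mul]; congr 1; ext x; ring
  have E2 : ∫ x, v x * φ x = ∫ x in tsupport φ, v x * φ x := by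
    rw [setIntegral_eq_integral_of_forall_compl_eq_zero
      (fun x hx => by rw [image_eq_zero_of_notMem_tsupport hx, mul_zero])]
  have L : Tendsto (fun j => ∫ x, U j x * P x) atTop (𝓝 (∫ x, v x * φ x)) := by
    simp_rw [E, E2]
    rw [tendsto_iff_norm_sub_tendsto_zero]
    have hL' := (hK _ hKc).mul_const M
    rw [zero_mul] at hL'
    refine squeeze_zero (fun _ => norm_nonneg _) (fun j => ?_) hL'
    have dU : Continuous (deriv (U j)) := (hU j).1.continuous_deriv (by simp)
    have i1 : IntegrableOn (fun x => c * ∫ t, deriv (U j) (x - t) * fkern α t) (tsupport φ) :=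
      (left_intOn h0 h1 (good_of_cs dU (hU j).2.deriv) hKc).const_mul c
    have i2 : IntegrableOn v (tsupport φ) := hv.integrableOn_isCompact hKc
    have hφm : AEStronglyMeasurable φ (volume.restrict (tsupport φ)) :=
      hφ.continuous.aestronglyMeasurable
    rw [← integral_sub (i1.mul_bdd hφm (Eventually.of_forall hM))
      (i2.mul_bdd hφm (Eventually.of_forall hM)), ← integral_mul_const]
    refine norm_integral_le_of_norm_le ((i1.sub i2).abs.mul_const _)
      (Eventually.of_forall fun x => ?_)
    rw [← sub_mul, norm_mul]
    exact mul_le_mul_of_nonneg_left (hM x) (norm_nonneg _)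
  exact tendsto_nhds_unique L R

open ContinuousLinearMap in
/-- mollification -/
noncomputable def moll (η f : ℝ → ℝ) : ℝ → ℝ := convolution η f (lsmul ℝ ℝ) volume

lemma moll_apply (η f : ℝ → ℝ) (x : ℝ) : moll η f x = ∫ t, η t * f (x - t) := rfl

lemma moll_apply' (η f : ℝ → ℝ) (x : ℝ) : moll η f x = ∫ t, η (x - t) * f t := by
  unfold moll
  rw [convolution_lsmul_swap]
  rfl

lemma moll_exists {η f : ℝ → ℝ} (hη : Continuous η) (hs : HasCompactSupport η)
    (hf : LocallyIntegrable f) (x : ℝ) : Integrable (fun t => η t * f (x - t)) :=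
  HasCompactSupport.convolutionExists_left (ContinuousLinearMap.lsmul ℝ ℝ) hs hη hf x

lemma moll_young {η f : ℝ → ℝ} (hη : Continuous η) (hs : HasCompactSupport η) (hpos : ∀ x, 0 ≤ η x)
    (h1 : ∫ x, η x = 1) (hf : Integrable f) : ∫ x, |moll η f x| ≤ ∫ x, |f x| := by
  have hηi : Integrable η := hη.integrable_of_hasCompactSupport hs
  have hi : Integrable (moll η (fun x => |f x|)) :=
    Integrable.integrable_convolution _ hηi hf.abs
  calc _ ≤ ∫ x, moll η (fun x => |f x|) x := by
        refine integral_mono (Integrable.integrable_convolution _ hηi hf).abs hi fun x => ?_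
        simp only [moll_apply]
        refine (abs_integral_le_integral_abs).trans (le_of_eq ?_)
        simp_rw [abs_mul, abs_of_nonneg (hpos _)]
    _ = _ := by
      unfold moll
      rw [integral_convolution _ hηi hf.abs, h1]
      simp

/-- mollifier sequence -/
noncomputable def bmp (n : ℕ) : ContDiffBump (0:ℝ) :=
  ⟨1 / (2 * (n + 1)), 1 / (n + 1), by positivity, by
    apply one_div_lt_one_div_of_lt <;> [positivity; linarith [show (0:ℝ) ≤ n from n.cast_nonneg]]⟩

/-- normalised mollifier sequence -/
noncomputable def eta (n : ℕ) : ℝ → ℝ := (bmp n).normed volume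

lemma eta_smooth (n : ℕ) : ContDiff ℝ (⊤ : ℕ∞) (eta n) := (bmp n).contDiff_normed
lemma eta_cs (n : ℕ) : HasCompactSupport (eta n) := (bmp n).hasCompactSupport_normed
lemma eta_nonneg (n : ℕ) (x : ℝ) : 0 ≤ eta n x := (bmp n).nonneg_normed x
lemma eta_int (n : ℕ) : ∫ x, eta n x = 1 := (bmp n).integral_normed
lemma eta_zero (n : ℕ) {x : ℝ} (hx : 1 ≤ |x|) : eta n x = 0 := by
  by_contra h
  have h2 : x ∈ Function.support (eta n) := h
  unfold eta at h2
  rw [ContDiffBump.support_normed_eq] at h2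
  have h3 : |x| < 1 / (n + 1) := by simpa [bmp] using h2
  have : (1:ℝ) / (n + 1) ≤ 1 := by
    rw [div_le_one (by positivity)]; linarith [show (0:ℝ) ≤ n from n.cast_nonneg]
  linarith
lemma bmp_tendsto : Tendsto (fun n => (bmp n).rOut) atTop (𝓝 0) :=
  tendsto_one_div_add_atTop_nhds_zero_nat

lemma moll_tendsto_cc {g : ℝ → ℝ} (hg : Continuous g) (hs : HasCompactSupport g) :
    Tendsto (fun n => ∫ x, |moll (eta n) g x - g x|) atTop (𝓝 0) := by
  obtain ⟨M, hM⟩ := hg.bounded_above_of_compact_support hs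
  obtain ⟨R, hR⟩ := hs.isCompact.isBounded.subset_closedBall 0
  have hz : ∀ x, x ∉ Icc (-(R + 1)) (R + 1) → ∀ t, |t| ≤ 1 → g (x - t) = 0 := by
    intro x hx t ht
    by_contra h
    have h2 : x - t ∈ tsupport g := subset_tsupport _ h
    have h3 := hR h2
    rw [mem_closedBall_zero_iff, Real.norm_eq_abs, abs_le] at h3
    rw [abs_le] at ht
    exact hx ⟨by linarith, by linarith⟩
  have key := tendsto_integral_of_dominated_convergence (μ := volume)
    (F := fun n x => |moll (eta n) g x - g x|) (f := fun _ => (0:ℝ))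
    (bound := (Icc (-(R + 1)) (R + 1)).indicator fun _ => M + M) (fun n => by
      have : Continuous (moll (eta n) g) :=
        (HasCompactSupport.contDiff_convolution_left _ (eta_cs n) (eta_smooth n)
          hg.locallyIntegrable).continuous
      exact (this.sub hg).abs.aestronglyMeasurable)
    (by
      rw [integrable_indicator_iff measurableSet_Icc]
      exact integrableOn_const (by simp))
    (fun n => Eventually.of_forall fun x => by
      by_cases hx : x ∈ Icc (-(R + 1)) (R + 1)
      · rw [indicator_of_mem hx, Real.norm_eq_abs, abs_abs]
        refine (abs_sub _ _).trans (add_le_add ?_ (hM x))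
        rw [moll_apply]
        have hi : Integrable (fun t => eta n t * M) :=
          ((eta_smooth n).continuous.integrable_of_hasCompactSupport (eta_cs n)).mul_const M
        have := norm_integral_le_of_norm_le (f := fun t => eta n t * g (x - t)) hi
          (Eventually.of_forall fun t => by
            rw [norm_mul, Real.norm_of_nonneg (eta_nonneg n t)]
            exact mul_le_mul_of_nonneg_left (hM _) (eta_nonneg n t))
        rwa [integral_mul_const, eta_int, one_mul] at this
      · rw [indicator_of_notMem hx, Real.norm_eq_abs, abs_abs, moll_apply]
        have h1 : g x = 0 := by simpa using hz x hx 0 (by simp)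
        have h2 : ∀ t, eta n t * g (x - t) = 0 := by
          intro t
          rcases le_total 1 |t| with h | h
          · rw [eta_zero n h, zero_mul]
          · rw [hz x hx t h, mul_zero]
        simp [h1, h2])
    (Eventually.of_forall fun x => by
      have h := ContDiffBump.convolution_tendsto_right_of_continuous (μ := volume)
        bmp_tendsto hg x
      have h2 := (h.sub_const (g x)).abs
      rw [sub_self, abs_zero] at h2
      exact h2)
  simpa using key

lemma moll_tendsto {f : ℝ → ℝ} (hf : Integrable f) :
    Tendsto (fun n => ∫ x, |moll (eta n) f x - f x|) atTop (𝓝 0) := by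
  rw [Metric.tendsto_nhds]
  intro ε hε
  obtain ⟨g, hgs, hfg, hgc, hgi⟩ := hf.exists_hasCompactSupport_integral_sub_le
    (show 0 < ε / 3 by positivity)
  have hg := moll_tendsto_cc hgc hgs
  rw [Metric.tendsto_nhds] at hg
  filter_upwards [hg (ε / 3) (by positivity)] with n hn
  rw [dist_zero_right, Real.norm_of_nonneg (integral_nonneg fun _ => abs_nonneg _)] at hn ⊢
  have ec := (eta_smooth n).continuous
  have ei : Integrable (eta n) := ec.integrable_of_hasCompactSupport (eta_cs n)
  have hd : Integrable (fun x => f x - g x) := hf.sub hgi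
  have i1 : Integrable (moll (eta n) (fun x => f x - g x)) :=
    Integrable.integrable_convolution _ ei hd
  have i2 : Integrable (moll (eta n) g) := Integrable.integrable_convolution _ ei hgi
  have a1 : Integrable (fun x => |moll (eta n) (fun x => f x - g x) x|) := i1.abs
  have a2 : Integrable (fun x => |moll (eta n) g x - g x|) := (i2.sub hgi).abs
  have a3 : Integrable (fun x => |f x - g x|) := hd.abs
  have a12 : Integrable (fun x => |moll (eta n) (fun x => f x - g x) x| +
      |moll (eta n) g x - g x|) := a1.add a2
  have y := moll_young ec (eta_cs n) (eta_nonneg n) (eta_int n) hd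
  have lin : ∀ x, moll (eta n) f x = moll (eta n) (fun x => f x - g x) x + moll (eta n) g x := by
    intro x
    simp only [moll_apply]
    rw [← integral_add (moll_exists ec (eta_cs n) hd.locallyIntegrable x)
      (moll_exists ec (eta_cs n) hgi.locallyIntegrable x)]
    congr 1; ext t; ring
  have : ∫ x, |moll (eta n) f x - f x| ≤ ∫ x, (|moll (eta n) (fun x => f x - g x) x| +
      |moll (eta n) g x - g x| + |f x - g x|) := by
    refine integral_mono_of_nonneg (Eventually.of_forall fun _ => abs_nonneg _)
      (a12.add a3) (Eventually.of_forall fun x => ?_)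
    simp only
    rw [lin x]
    have e : moll (eta n) (fun x => f x - g x) x + moll (eta n) g x - f x =
      moll (eta n) (fun x => f x - g x) x + (moll (eta n) g x - g x) - (f x - g x) := by ring
    rw [e]
    exact (abs_sub _ _).trans (by gcongr; exact abs_add_le _ _)
  rw [integral_add a12 a3, integral_add a1 a2] at this
  have y' : ∫ x, |moll (eta n) (fun x => f x - g x) x| ≤ ∫ x, |f x - g x| := y
  have hfg' : ∫ x, |f x - g x| ≤ ε / 3 := hfg
  linarith

lemma moll_tendsto_loc {v : ℝ → ℝ} (hv : LocallyIntegrable v) {K : Set ℝ} (hK : IsCompact K) :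
    Tendsto (fun n => ∫ x in K, |moll (eta n) v x - v x|) atTop (𝓝 0) := by
  obtain ⟨R, hR⟩ := hK.isBounded.subset_closedBall 0
  set J := Icc (-(R + 1)) (R + 1) with hJ
  have hw : Integrable (J.indicator v) := by
    rw [integrable_indicator_iff measurableSet_Icc]
    exact hv.integrableOn_isCompact isCompact_Icc
  refine squeeze_zero (fun _ => integral_nonneg fun _ => abs_nonneg _) (fun n => ?_)
    (moll_tendsto hw)
  have hi : Integrable (fun x => |moll (eta n) (J.indicator v) x - J.indicator v x|) :=
    ((Integrable.integrable_convolution _ ((eta_smooth n).continuous.integrable_of_hasCompactSupport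
      (eta_cs n)) hw).sub hw).abs
  refine le_trans (le_of_eq ?_) (setIntegral_le_integral (s := K) hi
    (Eventually.of_forall fun _ => abs_nonneg _))
  refine setIntegral_congr_fun hK.measurableSet fun x hx => ?_
  have h3 := hR hx
  rw [mem_closedBall_zero_iff, Real.norm_eq_abs, abs_le] at h3
  have e1 : J.indicator v x = v x :=
    indicator_of_mem (show x ∈ J from ⟨by linarith, by linarith⟩) _
  have e2 : moll (eta n) (J.indicator v) x = moll (eta n) v x := by
    simp only [moll_apply]
    congr 1; ext t
    rcases le_total 1 |t| with h | h
    · rw [eta_zero n h, zero_mul, zero_mul]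
    · rw [abs_le] at h
      rw [indicator_of_mem (show x - t ∈ J from ⟨by linarith, by linarith⟩)]
  simp only [e1, e2]

lemma good_mul_bdd {a b : ℝ → ℝ} (ha : Continuous a) (hb : Good b) {M : ℝ}
    (hM : ∀ x, |a x| ≤ M) : Good (fun x => a x * b x) := by
  obtain ⟨B, hB⟩ := hb.bdd
  refine ⟨ha.mul hb.cont, hb.int.bdd_mul ha.aestronglyMeasurable (Eventually.of_forall hM),
    M * B, fun t => ?_⟩
  rw [abs_mul]
  exact mul_le_mul (hM t) (hB t) (abs_nonneg _) ((abs_nonneg _).trans (hM t))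

lemma good_moll {η u : ℝ → ℝ} (hη : Continuous η) (hs : HasCompactSupport η) (hu : Integrable u) :
    Good (moll η u) := by
  have hi : Integrable η := hη.integrable_of_hasCompactSupport hs
  obtain ⟨M, hM⟩ := hη.bounded_above_of_compact_support hs
  refine ⟨HasCompactSupport.continuous_convolution_left _ hs hη hu.locallyIntegrable,
    Integrable.integrable_convolution _ hi hu, ∫ t, M * |u t|, fun x => ?_⟩
  rw [moll_apply']
  refine norm_integral_le_of_norm_le (f := fun t => η (x - t) * u t) (hu.abs.const_mul M)
    (Eventually.of_forall fun t => ?_)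
  rw [norm_mul]
  exact mul_le_mul_of_nonneg_right (hM _) (norm_nonneg _)

lemma cutoff {α : ℝ} (h0 : 0 < α) (h1 : α < 1) {s : ℝ → ℝ} (hs : ContDiff ℝ (⊤ : ℕ∞) s)
    (gs : Good s) (gds : Good (deriv s)) (N : ℝ) {δ : ℝ} (hδ : 0 < δ) :
    ∃ W : ℝ → ℝ, ContDiff ℝ (⊤ : ℕ∞) W ∧ HasCompactSupport W ∧ ∫ x, |W x - s x| ≤ δ ∧
      ∀ x, |x| ≤ N → |(∫ t, deriv W (x - t) * fkern α t) - ∫ t, deriv s (x - t) * fkern α t| ≤ δ := by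
  let b : ContDiffBump (0:ℝ) := ⟨1, 2, one_pos, by norm_num⟩
  have bs : ContDiff ℝ (⊤ : ℕ∞) b := b.contDiff
  have bd : Continuous (deriv b) := bs.continuous_deriv (by simp)
  have bcs : HasCompactSupport (deriv b) := b.hasCompactSupport.deriv
  obtain ⟨M, hM⟩ := bd.bounded_above_of_compact_support bcs
  have hM0 : 0 ≤ M := (norm_nonneg _).trans (hM 0)
  have bone : ∀ x : ℝ, |x| ≤ 1 → b x = 1 := fun x hx =>
    b.one_of_mem_closedBall (by simpa [b] using hx)
  have bdzero : ∀ x : ℝ, |x| < 1 → deriv b x = 0 := by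
    intro x hx
    have : (b : ℝ → ℝ) =ᶠ[𝓝 x] fun _ => 1 := by
      have ho : IsOpen {y : ℝ | |y| < 1} := isOpen_lt continuous_abs continuous_const
      filter_upwards [ho.mem_nhds hx] with y hy
      exact bone y (le_of_lt hy)
    rw [this.deriv_eq]; simp
  have b01 : ∀ x : ℝ, 0 ≤ b x ∧ b x ≤ 1 := fun x => ⟨b.nonneg, b.le_one⟩
  -- the cut off functions
  let W : ℝ → ℝ → ℝ := fun R x => b (R⁻¹ * x) * s x
  have Wd : ∀ R x, deriv (W R) x = R⁻¹ * deriv b (R⁻¹ * x) * s x + b (R⁻¹ * x) * deriv s x := by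
    intro R x
    have hb1 : HasDerivAt (fun x => b (R⁻¹ * x)) (deriv b (R⁻¹ * x) * R⁻¹) x := by
      have hb2 : HasDerivAt b (deriv b (R⁻¹ * x)) (R⁻¹ * x) :=
        (bs.differentiable (by simp) _).hasDerivAt
      have hb3 : HasDerivAt (fun x : ℝ => R⁻¹ * x) R⁻¹ x := by
        simpa using (hasDerivAt_id x).const_mul R⁻¹
      exact hb2.comp x hb3
    have := (hb1.mul (hs.differentiable (by simp) x).hasDerivAt).deriv
    rw [show W R = (fun x => b (R⁻¹ * x)) * s from rfl, this]
    ring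
  have WC : ∀ R, ContDiff ℝ (⊤ : ℕ∞) (W R) := fun R =>
    (bs.comp (contDiff_const.mul contDiff_id)).mul hs
  have WS : ∀ R : ℝ, 0 < R → HasCompactSupport (W R) := by
    intro R hR
    apply HasCompactSupport.mul_right
    have := b.hasCompactSupport.comp_homeomorph (Homeomorph.mulLeft₀ R⁻¹ (by positivity))
    exact this
  -- L1 convergence
  have T1 : Tendsto (fun n : ℕ => ∫ x, |W (n + 1) x - s x|) atTop (𝓝 0) := by
    have key := tendsto_integral_of_dominated_convergence (μ := volume)
      (F := fun (n : ℕ) x => |W (n + 1) x - s x|) (f := fun _ => (0:ℝ))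
      (bound := fun x => |s x|) (fun n => by
        exact ((WC _).continuous.sub hs.continuous).abs.aestronglyMeasurable) gs.int.abs
      (fun n => Eventually.of_forall fun x => by
        rw [Real.norm_eq_abs, abs_abs]
        have e : W (n + 1) x - s x = (b (((n:ℝ) + 1)⁻¹ * x) - 1) * s x := by
          simp only [W]; ring
        rw [e, abs_mul]
        refine mul_le_of_le_one_left (abs_nonneg _) ?_
        rw [abs_le]
        constructor <;> linarith [(b01 (((n:ℝ) + 1)⁻¹ * x)).1, (b01 (((n:ℝ) + 1)⁻¹ * x)).2])
      (Eventually.of_forall fun x => by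
        apply tendsto_const_nhds.congr'
        obtain ⟨m, hm⟩ := exists_nat_ge |x|
        filter_upwards [eventually_ge_atTop m] with n hn
        have hn' : (m:ℝ) ≤ n := by exact_mod_cast hn
        have : b (((n:ℝ) + 1)⁻¹ * x) = 1 := by
          apply bone
          rw [abs_mul, abs_of_pos (by positivity), inv_mul_le_iff₀ (by positivity)]
          linarith
        simp [W, this])
    simpa using key
  -- uniform convergence
  set A := ∫ x, (M * |s x| + |deriv s x|) with hA
  have Ai : Integrable (fun x => M * |s x| + |deriv s x|) :=
    (gs.int.abs.const_mul M).add gds.int.abs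
  have T2 : Tendsto (fun n : ℕ => ((n:ℝ) + 1 - N) ^ (-α) * A) atTop (𝓝 0) := by
    have h : Tendsto (fun n : ℕ => (n:ℝ) + 1 - N) atTop atTop := by
      have : (fun n : ℕ => (n:ℝ) + 1 - N) = fun n : ℕ => (n:ℝ) + (1 - N) := by ext; ring
      rw [this]
      exact tendsto_atTop_add_const_right _ _ tendsto_natCast_atTop_atTop
    simpa using ((tendsto_rpow_neg_atTop h0).comp h).mul_const A
  obtain ⟨m, hm⟩ := exists_nat_ge N
  obtain ⟨n, hn1, hn2, hn3⟩ := ((T1.eventually (gt_mem_nhds hδ)).and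
    ((T2.eventually (gt_mem_nhds hδ)).and (eventually_ge_atTop m))).exists
  have hnN : 0 < (n:ℝ) + 1 - N := by
    have : (m:ℝ) ≤ n := by exact_mod_cast hn3
    linarith
  set R : ℝ := (n:ℝ) + 1 with hR
  have R1 : 1 ≤ R := by rw [hR]; linarith [show (0:ℝ) ≤ n from n.cast_nonneg]
  have R0 : 0 < R := by linarith
  refine ⟨W R, WC R, WS R R0, hn1.le, fun x hx => ?_⟩
  have Wc : Continuous (deriv (W R)) := (WC R).continuous_deriv (by simp)
  obtain ⟨C1, hC1⟩ := good_sub h0 h1 (good_of_cs Wc (WS R R0).deriv)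
  obtain ⟨C2, hC2⟩ := good_sub h0 h1 gds
  rw [← integral_sub (hC1 x).1 (hC2 x).1]
  refine le_trans ?_ hn2.le
  have e : A = ∫ t, (M * |s (x - t)| + |deriv s (x - t)|) := by
    rw [hA, ← integral_sub_left_eq_self (fun x => M * |s x| + |deriv s x|) volume x]
  rw [e, ← integral_const_mul]
  refine norm_integral_le_of_norm_le (f := fun t => deriv (W R) (x - t) * fkern α t -
    deriv s (x - t) * fkern α t) ((Ai.comp_sub_left x).const_mul _)
    (Eventually.of_forall fun t => ?_)
  rw [← sub_mul, norm_mul, Real.norm_of_nonneg (fkern_nonneg α t), Real.norm_eq_abs, mul_comm]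
  rw [abs_le] at hx
  have hp : 0 ≤ (R - N) ^ (-α) := Real.rpow_nonneg hnN.le _
  by_cases ht : R - N ≤ t
  · refine mul_le_mul (fkern_le h0 hnN ht) ?_ (abs_nonneg _) hp
    rw [Wd]
    set y := x - t
    have e2 : R⁻¹ * deriv b (R⁻¹ * y) * s y + b (R⁻¹ * y) * deriv s y - deriv s y =
      R⁻¹ * deriv b (R⁻¹ * y) * s y + (b (R⁻¹ * y) - 1) * deriv s y := by ring
    rw [e2]
    refine (abs_add_le _ _).trans (add_le_add ?_ ?_)
    · rw [abs_mul, abs_mul, abs_of_pos (inv_pos.2 R0)]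
      refine mul_le_mul_of_nonneg_right ?_ (abs_nonneg _)
      have i1 : R⁻¹ ≤ 1 := inv_le_one_of_one_le₀ R1
      calc R⁻¹ * |deriv b (R⁻¹ * y)| ≤ 1 * M :=
            mul_le_mul i1 (hM _) (abs_nonneg _) zero_le_one
        _ = M := one_mul M
    · rw [abs_mul]
      refine mul_le_of_le_one_left (abs_nonneg _) ?_
      rw [abs_le]
      constructor <;> linarith [(b01 (R⁻¹ * y)).1, (b01 (R⁻¹ * y)).2]
  · have hz : fkern α t * |deriv (W R) (x - t) - deriv s (x - t)| = 0 := by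
      by_cases ht0 : 0 < t
      · have hy : |R⁻¹ * (x - t)| < 1 := by
          rw [abs_mul, abs_of_pos (inv_pos.2 R0), inv_mul_lt_iff₀ R0, abs_lt]
          push Not at ht
          constructor <;> linarith
        rw [Wd, bdzero _ hy, bone _ hy.le]
        simp
      · have : fkern α t = 0 := by
          unfold fkern; rw [indicator_of_notMem (show t ∉ Ioi (0:ℝ) from ht0)]
        rw [this, zero_mul]
    rw [hz]
    positivity

lemma left_moll {α : ℝ} (h0 : 0 < α) (h1 : α < 1) (c : ℝ) {u v η : ℝ → ℝ} (hu : Integrable u)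
    (H : ∀ φ : ℝ → ℝ, ContDiff ℝ (⊤ : ℕ∞) φ → HasCompactSupport φ →
      ∫ x, v x * φ x = ∫ x, u x * (-c * ∫ t, deriv φ (x + t) * fkern α t))
    (hη : ContDiff ℝ (⊤ : ℕ∞) η) (hs : HasCompactSupport η) (x : ℝ) :
    c * ∫ t, deriv (moll η u) (x - t) * fkern α t = moll η v x := by
  have dη : Continuous (deriv η) := hη.continuous_deriv (by simp)
  have hd : ∀ y, deriv (moll η u) y = ∫ z, deriv η (y - z) * u z := by
    intro y
    rw [← moll_apply']
    exact (HasCompactSupport.hasDerivAt_convolution_left _ hs (hη.of_le (by simp))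
      hu.locallyIntegrable y).deriv
  have hφ : ContDiff ℝ (⊤ : ℕ∞) (fun z => η (x - z)) := hη.comp (contDiff_const.sub contDiff_id)
  have hφs : HasCompactSupport (fun z => η (x - z)) :=
    hs.comp_homeomorph (Homeomorph.subLeft x)
  have hφd : ∀ z, deriv (fun z => η (x - z)) z = - deriv η (x - z) := fun z =>
    deriv_comp_const_sub ..
  have dφ : Continuous (deriv (fun z => η (x - z))) := hφ.continuous_deriv (by simp)
  obtain ⟨C, hC⟩ := good_add h0 h1 (good_of_cs dφ hφs.deriv)
  have I := kern_fubini (α := α) hu (H := fun p => deriv (fun z => η (x - z)) (p.1 + p.2))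
    (by fun_prop) hC
  have h := H _ hφ hφs
  rw [moll_apply']
  calc _ = -c * ∫ t, ∫ z, u z * (deriv (fun z => η (x - z)) (z + t) * fkern α t) := by
        rw [neg_mul, ← mul_neg, ← integral_neg]
        congr 2; ext t
        rw [hd, ← integral_mul_const, ← integral_neg]
        congr 1; ext z
        rw [hφd, show x - t - z = x - (z + t) by ring]
        ring
    _ = -c * ∫ z, ∫ t, u z * (deriv (fun z => η (x - z)) (z + t) * fkern α t) := by
        rw [integral_integral_swap
          (f := fun z t => u z * (deriv (fun z => η (x - z)) (z + t) * fkern α t)) I]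
    _ = ∫ z, u z * (-c * ∫ t, deriv (fun z => η (x - z)) (z + t) * fkern α t) := by
        rw [← integral_const_mul]
        congr 1; ext z
        rw [integral_const_mul]; ring
    _ = _ := by
        rw [← h]; congr 1; ext z; ring

lemma forward {α : ℝ} (h0 : 0 < α) (h1 : α < 1) (c : ℝ) {u v : ℝ → ℝ} (hu : Integrable u)
    (hv : LocallyIntegrable v)
    (H : ∀ φ : ℝ → ℝ, ContDiff ℝ (⊤ : ℕ∞) φ → HasCompactSupport φ →
      ∫ x, v x * φ x = ∫ x, u x * (-c * ∫ t, deriv φ (x + t) * fkern α t)) :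
    ∃ U : ℕ → ℝ → ℝ, (∀ j, ContDiff ℝ (⊤ : ℕ∞) (U j) ∧ HasCompactSupport (U j)) ∧
      Tendsto (fun j => ∫ x, |U j x - u x|) atTop (𝓝 0) ∧
      ∀ K : Set ℝ, IsCompact K → Tendsto (fun j => ∫ x in K,
        |c * (∫ t, deriv (U j) (x - t) * fkern α t) - v x|) atTop (𝓝 0) := by
  have sm : ∀ n, ContDiff ℝ (⊤ : ℕ∞) (moll (eta n) u) := fun n =>
    HasCompactSupport.contDiff_convolution_left _ (eta_cs n) (eta_smooth n) hu.locallyIntegrable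
  have g1 : ∀ n, Good (moll (eta n) u) := fun n =>
    good_moll (eta_smooth n).continuous (eta_cs n) hu
  have g2 : ∀ n, Good (deriv (moll (eta n) u)) := by
    intro n
    have : deriv (moll (eta n) u) = moll (deriv (eta n)) u := by
      ext y
      exact (HasCompactSupport.hasDerivAt_convolution_left _ (eta_cs n)
        ((eta_smooth n).of_le (by simp)) hu.locallyIntegrable y).deriv
    rw [this]
    exact good_moll ((eta_smooth n).continuous_deriv (by simp)) (eta_cs n).deriv hu
  have T : Tendsto (fun n : ℕ => (1:ℝ) / (n + 1)) atTop (𝓝 0) :=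
    tendsto_one_div_add_atTop_nhds_zero_nat
  choose U hUc hUs hU1 hU2 using fun n : ℕ => cutoff h0 h1 (sm n) (g1 n) (g2 n) (n:ℝ)
    (show (0:ℝ) < 1 / (n + 1) by positivity)
  refine ⟨U, fun j => ⟨hUc j, hUs j⟩, ?_, fun K hK => ?_⟩
  · have hb := T.add (moll_tendsto hu)
    rw [add_zero] at hb
    refine squeeze_zero (fun _ => integral_nonneg fun _ => abs_nonneg _) (fun n => ?_) hb
    refine le_trans ?_ (add_le_add_left (hU1 n) _)
    have iU : Integrable (U n) := (hUc n).continuous.integrable_of_hasCompactSupport (hUs n)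
    have a1 : Integrable (fun x => |U n x - moll (eta n) u x|) := (iU.sub (g1 n).int).abs
    have a2 : Integrable (fun x => |moll (eta n) u x - u x|) := ((g1 n).int.sub hu).abs
    rw [← integral_add a1 a2]
    refine integral_mono (iU.sub hu).abs (a1.add a2)
      fun x => ?_
    exact abs_sub_le _ _ _
  · have hb := ((T.const_mul |c|).mul_const (volume.real K)).add (moll_tendsto_loc hv hK)
    rw [mul_zero, zero_mul, add_zero] at hb
    obtain ⟨R, hR⟩ := hK.isBounded.subset_closedBall 0
    obtain ⟨m, hm⟩ := exists_nat_ge R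
    refine squeeze_zero' (Eventually.of_forall fun _ => integral_nonneg fun _ => abs_nonneg _)
      ?_ hb
    filter_upwards [eventually_ge_atTop m] with n hn
    have hn' : (m:ℝ) ≤ n := by exact_mod_cast hn
    have dU : Continuous (deriv (U n)) := (hUc n).continuous_deriv (by simp)
    have i1 : IntegrableOn (fun x => c * ∫ t, deriv (U n) (x - t) * fkern α t) K :=
      (left_intOn h0 h1 (good_of_cs dU (hUs n).deriv) hK).const_mul c
    have i2 : IntegrableOn v K := hv.integrableOn_isCompact hK
    have i3 : IntegrableOn (moll (eta n) v) K :=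
      (HasCompactSupport.continuous_convolution_left _ (eta_cs n) (eta_smooth n).continuous
        hv).continuousOn.integrableOn_compact hK
    have i4 : IntegrableOn (fun _ : ℝ => |c| * (1 / ((n:ℝ) + 1))) K :=
      integrableOn_const hK.measure_lt_top.ne
    have e : |c| * (1 / ((n:ℝ) + 1)) * volume.real K = ∫ _ in K, |c| * (1 / ((n:ℝ) + 1)) := by
      rw [setIntegral_const, smul_eq_mul, mul_comm]
    have i5 : IntegrableOn (fun x => |moll (eta n) v x - v x|) K := (i3.sub i2).abs
    rw [e, ← integral_add i4 i5]
    refine setIntegral_mono_on (i1.sub i2).abs (i4.add i5) hK.measurableSet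
      fun x hx => ?_
    have h3 := hR hx
    rw [mem_closedBall_zero_iff, Real.norm_eq_abs] at h3
    have h4 := hU2 n x (by linarith)
    refine (abs_sub_le _ (moll (eta n) v x) _).trans (add_le_add_left ?_ _)
    rw [← left_moll h0 h1 c hu H (eta_smooth n) (eta_cs n) x, ← mul_sub, abs_mul]
    gcongr

theorem stmt_6 (α : ℝ) (hα₀ : 0 < α) (hα₁ : α < 1)
    (u v : ℝ → ℝ) (hu : Integrable u) (hv : LocallyIntegrable v) :
    (∀ φ : ℝ → ℝ, ContDiff ℝ (⊤ : ℕ∞) φ → HasCompactSupport φ →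
        ∫ x, v x * φ x =
          ∫ x, u x * (-(1 / Real.Gamma (1 - α)) * ∫ y in Set.Ioi x, deriv φ y * (y - x) ^ (-α))) ↔
    (∃ U : ℕ → ℝ → ℝ,
      (∀ j, ContDiff ℝ (⊤ : ℕ∞) (U j) ∧ HasCompactSupport (U j)) ∧
      Tendsto (fun j => ∫ x, |U j x - u x|) atTop (𝓝 0) ∧
      ∀ K : Set ℝ, IsCompact K →
        Tendsto (fun j => ∫ x in K,
            |(1 / Real.Gamma (1 - α)) * (∫ y in Set.Iio x, deriv (U j) y * (x - y) ^ (-α)) - v x|)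
          atTop (𝓝 0)) := by
  simp only [right_eq, left_eq]
  constructor
  · intro H
    exact forward hα₀ hα₁ _ hu hv H
  · rintro ⟨U, hU, hL, hK⟩ φ hφ hφs
    exact backward hα₀ hα₁ _ hu hv hU hL hK hφ hφs
end

section
/- Fundamental Theorem of Weak Fractional Calculus on ℝ: let 0 < α < 1 and let u, v ∈ L¹(ℝ) satisfy u(x) = (1/Γ(α)) ∫_{−∞}^x v(y)(x−y)^{α−1} dy for almost every x ∈ ℝ. Then v is the left weak fractional derivative of order α of u; that is, ∫_ℝ v(x)φ(x) dx = ∫_ℝ u(x)·( −(1/Γ(1−α)) ∫_x^∞ φ′(y)(y−x)^{−α} dy ) dx for every infinitely differentiable compactly supported φ : ℝ → ℝ. -/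
open MeasureTheory Real Set
open scoped ENNReal

noncomputable def kerP (s : ℝ) (t : ℝ) : ℝ := (Ioi (0:ℝ)).indicator (fun t => t ^ s) t

lemma kerP_meas (s : ℝ) : Measurable (kerP s) := by
  unfold kerP
  exact (measurable_id.pow_const s).indicator measurableSet_Ioi

lemma kerP_nonneg (s t : ℝ) : 0 ≤ kerP s t := by
  unfold kerP
  exact indicator_nonneg (fun x hx => Real.rpow_nonneg (le_of_lt hx) _) _

lemma beta_real (α : ℝ) (hα₀ : 0 < α) (hα₁ : α < 1) (a : ℝ) (ha : 0 < a) :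
    ∫ x in (0:ℝ)..a, x ^ (α - 1) * (a - x) ^ (-α) = Gamma α * Gamma (1 - α) := by
  have h := Complex.betaIntegral_scaled (α : ℂ) ((1 - α : ℝ) : ℂ) ha
  have h2 := Complex.Gamma_mul_Gamma_eq_betaIntegral (s := (α : ℂ)) (t := ((1 - α : ℝ) : ℂ))
    (by simpa using hα₀) (by simpa using hα₁)
  have e1 : (α : ℂ) + ((1 - α : ℝ) : ℂ) = 1 := by push_cast; ring
  rw [e1, Complex.Gamma_one, one_mul] at h2
  rw [e1, sub_self, Complex.cpow_zero, one_mul, ← h2, Complex.Gamma_ofReal,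
    Complex.Gamma_ofReal] at h
  have h3 : (∫ x in (0:ℝ)..a, (x:ℂ) ^ ((α:ℂ) - 1) * ((a:ℂ) - x) ^ (((1 - α : ℝ) : ℂ) - 1))
      = ((∫ x in (0:ℝ)..a, x ^ (α - 1) * (a - x) ^ (-α) : ℝ) : ℂ) := by
    rw [← intervalIntegral.integral_ofReal]
    apply intervalIntegral.integral_congr
    intro x hx
    rw [uIcc_of_le ha.le] at hx
    have hx1 : 0 ≤ a - x := sub_nonneg.2 hx.2
    simp only
    rw [Complex.ofReal_mul, Complex.ofReal_cpow hx.1, Complex.ofReal_cpow hx1]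
    push_cast
    congr 2
    ring
  rw [h3] at h
  exact_mod_cast h

lemma ker_integral0 (α : ℝ) (hα₀ : 0 < α) (hα₁ : α < 1) (a : ℝ) (ha : 0 < a) :
    ∫ x, kerP (α - 1) x * kerP (-α) (a - x) = Gamma α * Gamma (1 - α) := by
  rw [← beta_real α hα₀ hα₁ a ha, intervalIntegral.integral_of_le ha.le,
    integral_Ioc_eq_integral_Ioo, ← integral_indicator measurableSet_Ioo]
  congr 1
  ext x
  by_cases h1 : 0 < x <;> by_cases h2 : x < a <;> simp [kerP, indicator, h1, h2]

lemma ker_integral (α : ℝ) (hα₀ : 0 < α) (hα₁ : α < 1) (y z : ℝ) :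
    Integrable (fun x => kerP (α - 1) (x - y) * kerP (-α) (z - x)) ∧
    ∫ x, kerP (α - 1) (x - y) * kerP (-α) (z - x)
      = (Ioi y).indicator (fun _ => Gamma α * Gamma (1 - α)) z := by
  by_cases h : y < z
  · have e : ∫ x, kerP (α - 1) (x - y) * kerP (-α) (z - x) = Gamma α * Gamma (1 - α) := by
      rw [← ker_integral0 α hα₀ hα₁ (z - y) (by linarith),
        ← integral_add_right_eq_self (fun x => kerP (α - 1) (x - y) * kerP (-α) (z - x)) y]
      congr 1
      ext x
      rw [add_sub_cancel_right, show z - (x + y) = z - y - x by ring]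
    refine ⟨?_, by simp [e, h]⟩
    by_contra hn
    rw [integral_undef hn] at e
    have := mul_pos (Gamma_pos_of_pos hα₀) (Gamma_pos_of_pos (sub_pos.2 hα₁))
    linarith
  · have e : (fun x => kerP (α - 1) (x - y) * kerP (-α) (z - x)) = fun _ => 0 := by
      ext x
      by_cases h1 : y < x
      · have : ¬ x < z := fun h' => h (h1.trans h')
        simp [kerP, this]
      · simp [kerP, h1]
    rw [e]
    simp [h]

theorem stmt_11 (α : ℝ) (hα₀ : 0 < α) (hα₁ : α < 1)
    (u v : ℝ → ℝ) (hu : Integrable u) (hv : Integrable v)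
    (heq : ∀ᵐ x : ℝ, u x = (1 / Real.Gamma α) * ∫ y in Set.Iio x, v y * (x - y) ^ (α - 1)) :
    ∀ φ : ℝ → ℝ, ContDiff ℝ (⊤ : ℕ∞) φ → HasCompactSupport φ →
      ∫ x, v x * φ x =
        ∫ x, u x * (-(1 / Real.Gamma (1 - α)) * ∫ y in Set.Ioi x, deriv φ y * (y - x) ^ (-α)) := by
  intro φ hφ hc
  have hg1 := Gamma_pos_of_pos hα₀
  have hg2 := Gamma_pos_of_pos (sub_pos.2 hα₁)
  set C := Gamma α * Gamma (1 - α) with hC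
  have hCpos : 0 < C := mul_pos hg1 hg2
  have hdc : Continuous (deriv φ) := hφ.continuous_deriv (by simp)
  have hd : Integrable (deriv φ) := hdc.integrable_of_hasCompactSupport hc.deriv
  let F : (ℝ × ℝ) × ℝ → ℝ := fun p =>
    (v p.1.1 * deriv φ p.1.2) * (kerP (α - 1) (p.2 - p.1.1) * kerP (-α) (p.1.2 - p.2))
  have hvd : Integrable (fun q : ℝ × ℝ => v q.1 * deriv φ q.2) (volume.prod volume) :=
    hv.mul_prod hd
  have hS : MeasurableSet {q : ℝ × ℝ | q.1 < q.2} := measurableSet_lt measurable_fst measurable_snd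
  have hFm : AEStronglyMeasurable F ((volume.prod volume).prod volume) := by
    refine (hvd.aestronglyMeasurable.comp_fst).mul ?_
    refine Measurable.aestronglyMeasurable ?_
    exact ((kerP_meas _).comp (by fun_prop)).mul ((kerP_meas _).comp (by fun_prop))
  have hF : Integrable F ((volume.prod volume).prod volume) := by
    rw [integrable_prod_iff hFm]
    refine ⟨Filter.Eventually.of_forall fun q =>
      (ker_integral α hα₀ hα₁ q.1 q.2).1.const_mul (v q.1 * deriv φ q.2), ?_⟩
    have : (fun q : ℝ × ℝ => ∫ x, ‖F (q, x)‖) =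
        {q : ℝ × ℝ | q.1 < q.2}.indicator (fun q => ‖v q.1 * deriv φ q.2‖ * C) := by
      ext q
      have : ∀ x, ‖F (q, x)‖ = ‖v q.1 * deriv φ q.2‖ *
          (kerP (α - 1) (x - q.1) * kerP (-α) (q.2 - x)) := by
        intro x
        simp only [F]
        rw [norm_mul, Real.norm_of_nonneg (mul_nonneg (kerP_nonneg _ _) (kerP_nonneg _ _))]
      simp_rw [this]
      rw [integral_const_mul, (ker_integral α hα₀ hα₁ q.1 q.2).2]
      by_cases h : q.1 < q.2 <;> simp [h, hC]
    rw [this]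
    exact (hvd.norm.mul_const C).indicator hS
  have hG : Integrable ({q : ℝ × ℝ | q.1 < q.2}.indicator (fun q => v q.1 * deriv φ q.2))
    (volume.prod volume) := hvd.indicator hS
  have hswap := integral_integral_swap (f := fun q x => F (q, x)) hF
  -- left side of swap
  have hL : ∀ q : ℝ × ℝ, ∫ x, F (q, x) =
      C * {q : ℝ × ℝ | q.1 < q.2}.indicator (fun q => v q.1 * deriv φ q.2) q := by
    intro q
    simp only [F]
    rw [integral_const_mul, (ker_integral α hα₀ hα₁ q.1 q.2).2]
    by_cases h : q.1 < q.2 <;> simp [h, hC]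
    ring
  have hIoi : ∀ y, ∫ z in Ioi y, deriv φ z = - φ y := by
    intro y
    exact hc.integral_Ioi_deriv_eq (hφ.of_le (by simp)) y
  have hLL : ∫ q : ℝ × ℝ, ∫ x, F (q, x) ∂volume ∂(volume.prod volume) = - (C * ∫ y, v y * φ y) := by
    simp_rw [hL]
    rw [integral_const_mul, integral_prod _ hG, ← mul_neg, ← integral_neg]
    congr 2
    ext y
    rw [← mul_neg, ← hIoi y, ← integral_indicator measurableSet_Ioi, ← integral_const_mul]
    congr 1
    ext z
    by_cases h : y < z <;> simp [h]
  have hRR : ∀ x, ∫ q : ℝ × ℝ, F (q, x) ∂(volume.prod volume) =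
      (∫ y in Set.Iio x, v y * (x - y) ^ (α - 1)) * ∫ y in Set.Ioi x, deriv φ y * (y - x) ^ (-α) := by
    intro x
    rw [← integral_indicator measurableSet_Iio, ← integral_indicator measurableSet_Ioi,
      ← integral_prod_mul]
    congr 1
    ext q
    by_cases h1 : q.1 < x <;> by_cases h2 : x < q.2 <;> simp [F, kerP, h1, h2]
    ring
  rw [hLL] at hswap
  simp_rw [hRR] at hswap
  have : ∫ x, u x * (-(1 / Real.Gamma (1 - α)) * ∫ y in Set.Ioi x, deriv φ y * (y - x) ^ (-α)) =
      ∫ x, -(1 / C) * ((∫ y in Set.Iio x, v y * (x - y) ^ (α - 1)) *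
        ∫ y in Set.Ioi x, deriv φ y * (y - x) ^ (-α)) := by
    apply integral_congr_ae
    filter_upwards [heq] with x hx
    rw [hx, hC]
    field_simp
  rw [this, integral_const_mul, ← hswap]
  field_simp
end

section
/- Inclusion of the Gagliardo space in the new fractional Sobolev space for p = 1: let 0 < α < 1 and suppose u ∈ L¹(ℝ) has finite Gagliardo seminorm [u] := ∫_ℝ ∫_ℝ |u(x) − u(y)| / |x−y|^{1+α} dy dx < ∞. Then u has a left weak fractional derivative v of order α with v ∈ L¹(ℝ) and ‖v‖_{L¹(ℝ)} ≤ (α/Γ(1−α))·[u]. (The analogous statement holds for the right weak fractional derivative.) -/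
open MeasureTheory Real Set
open scoped ENNReal

/-- Integrability of a function on `(0,∞)` bounded by `K h ^ (-α)` near zero and `M h ^ (-1-α)` far away. -/
lemma aux_kernel (α : ℝ) (hα₀ : 0 < α) (hα₁ : α < 1) (K M : ℝ) :
    Integrable (fun h : ℝ => (Ioc (0:ℝ) 1).indicator (fun h => K * h ^ (-α)) h +
      (Ioi (1:ℝ)).indicator (fun h => M * h ^ (-1-α)) h) := by
  refine Integrable.add ?_ ?_
  · rw [integrable_indicator_iff measurableSet_Ioc]
    refine Integrable.const_mul ?_ _
    have := (intervalIntegral.intervalIntegrable_rpow' (a := 0) (b := 1) (r := -α) (by linarith))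
    rw [intervalIntegrable_iff_integrableOn_Ioc_of_le zero_le_one] at this
    exact this
  · rw [integrable_indicator_iff measurableSet_Ioi]
    refine Integrable.const_mul ?_ _
    exact integrableOn_Ioi_rpow_of_lt (by linarith) zero_lt_one

lemma aux_bounds (φ : ℝ → ℝ) (hφ : ContDiff ℝ (⊤ : ℕ∞) φ) (hc : HasCompactSupport φ) :
    ∃ K M : ℝ, 0 ≤ K ∧ 0 ≤ M ∧ (∀ x, |deriv φ x| ≤ K) ∧ (∀ x h, |φ x - φ (x + h)| ≤ M) ∧
      (∀ x h, |φ x - φ (x + h)| ≤ K * |h|) := by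
  obtain ⟨M, hM⟩ := hc.exists_bound_of_continuous hφ.continuous
  obtain ⟨K, hK⟩ := hc.deriv.exists_bound_of_continuous (hφ.continuous_deriv (by simp))
  refine ⟨K, M + M, (norm_nonneg _).trans (hK 0), ?_, hK, ?_, ?_⟩
  · have := (norm_nonneg _).trans (hM 0)
    linarith
  · intro x h
    exact (norm_sub_le _ _).trans (add_le_add (hM _) (hM _))
  · intro x h
    have := Convex.norm_image_sub_le_of_norm_deriv_le (f := φ) (s := univ) (C := K)
      (fun y _ => (hφ.differentiable (by simp)) y) (fun y _ => hK y) convex_univ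
      (mem_univ (x + h)) (mem_univ x)
    simpa using this

lemma aux_dom (α : ℝ) (K M d h : ℝ) (hh : 0 < h) (h1 : |d| ≤ M)
    (h2 : |d| ≤ K * |h|) :
    |d * h ^ (-1-α)| ≤ (Ioc (0:ℝ) 1).indicator (fun h => K * h ^ (-α)) h +
      (Ioi (1:ℝ)).indicator (fun h => M * h ^ (-1-α)) h := by
  have hp : 0 < h ^ (-1-α) := rpow_pos_of_pos hh _
  rw [abs_mul, abs_of_pos hp]
  by_cases h1' : h ≤ 1
  · rw [indicator_of_mem (show h ∈ Ioc (0:ℝ) 1 from ⟨hh, h1'⟩),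
      indicator_of_notMem (by simpa using h1'), add_zero]
    have : h ^ (-α) = |h| * h ^ (-1-α) := by
      rw [abs_of_pos hh]
      nth_rewrite 2 [← rpow_one h]
      rw [← rpow_add hh]; congr 1; ring
    rw [this, ← mul_assoc]
    gcongr
  · push Not at h1'
    rw [indicator_of_notMem (by simp [h1']), indicator_of_mem (by simpa using h1'), zero_add]
    gcongr

lemma aux_parts (α : ℝ) (hα₀ : 0 < α) (hα₁ : α < 1) (φ : ℝ → ℝ)
    (hφ : ContDiff ℝ (⊤ : ℕ∞) φ) (hc : HasCompactSupport φ) (x : ℝ) :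
    α * ∫ h in Ioi (0:ℝ), (φ x - φ (x + h)) * h ^ (-1-α) =
      - ∫ y in Ioi x, deriv φ y * (y - x) ^ (-α) := by
  obtain ⟨K, M, hK0, hM0, hd, hb, hl⟩ := aux_bounds φ hφ hc
  have hdc : Continuous (deriv φ) := hφ.continuous_deriv (by simp)
  have hshift : ∫ y in Ioi x, deriv φ y * (y - x) ^ (-α) =
      ∫ h in Ioi (0:ℝ), deriv φ (x + h) * h ^ (-α) := by
    rw [← integral_indicator measurableSet_Ioi, ← integral_indicator measurableSet_Ioi,
      ← integral_add_left_eq_self _ x]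
    congr 1
    ext h
    simp [indicator]
  have hm : Measurable (fun h : ℝ => h ^ (-1-α)) := by fun_prop
  have hI1 : IntegrableOn (fun h => (φ x - φ (x + h)) * h ^ (-1-α)) (Ioi (0:ℝ)) := by
    refine Integrable.mono' (aux_kernel α hα₀ hα₁ K M).integrableOn ?_ ?_
    · exact (Measurable.mul (by have := hφ.continuous; fun_prop) hm).aestronglyMeasurable
    · refine (ae_restrict_iff' measurableSet_Ioi).2 (Filter.Eventually.of_forall fun h hh => ?_)
      exact aux_dom α K M _ h hh (hb _ _) (hl _ _)
  have hI2 : IntegrableOn (fun h => deriv φ (x + h) * h ^ (-α)) (Ioi (0:ℝ)) := by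
    have i2 : Integrable (fun h => deriv φ (x + h)) :=
      (hdc.integrable_of_hasCompactSupport hc.deriv).comp_add_left x
    refine Integrable.mono' ((aux_kernel α hα₀ hα₁ K 0).add i2.norm).integrableOn ?_ ?_
    · exact (Measurable.mul (by fun_prop) (by fun_prop)).aestronglyMeasurable
    · refine (ae_restrict_iff' measurableSet_Ioi).2 (Filter.Eventually.of_forall fun h hh => ?_)
      have hh' : 0 < h := hh
      have hp : 0 < h ^ (-α) := rpow_pos_of_pos hh' _
      simp only [Pi.add_apply, norm_mul, Real.norm_eq_abs, abs_of_pos hp]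
      by_cases h1' : h ≤ 1
      · rw [indicator_of_mem (show h ∈ Ioc (0:ℝ) 1 from ⟨hh, h1'⟩),
          indicator_of_notMem (by simpa using h1'), add_zero]
        have := mul_le_mul_of_nonneg_right (hd (x + h)) hp.le
        have := abs_nonneg (deriv φ (x + h))
        linarith
      · push Not at h1'
        rw [indicator_of_notMem (by simp [h1']), indicator_of_mem (by simpa using h1'), zero_add]
        have : h ^ (-α) ≤ 1 := rpow_le_one_of_one_le_of_nonpos h1'.le (by linarith)
        have := mul_le_mul_of_nonneg_left this (abs_nonneg (deriv φ (x + h)))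
        linarith
  have key := integral_Ioi_mul_deriv_eq_deriv_mul (a := (0:ℝ)) (a' := (0:ℝ)) (b' := (0:ℝ))
    (u := fun h => φ x - φ (x + h)) (u' := fun h => - deriv φ (x + h))
    (v := fun h => - h ^ (-α)) (v' := fun h => α * h ^ (-1-α)) ?_ ?_ ?_ ?_ ?_ ?_
  · rw [hshift, ← integral_const_mul]
    calc _ = ∫ h in Ioi (0:ℝ), (φ x - φ (x + h)) * (α * h ^ (-1-α)) := by
          congr 1; ext h; ring
      _ = _ := by
          rw [key]; simp
  · intro h _
    have h1 : HasDerivAt φ (deriv φ (x + h)) (x + h) :=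
      ((hφ.differentiable (by simp)) _).hasDerivAt
    exact (h1.comp_const_add x h).const_sub (φ x)
  · intro h hh
    have := (Real.hasDerivAt_rpow_const (x := h) (p := -α) (Or.inl (ne_of_gt hh))).neg
    rw [show -(-α * h ^ (-α - 1)) = α * h ^ (-1-α) by
      rw [show -1 - α = -α - 1 by ring]; ring] at this
    exact this
  · refine (hI1.const_mul α).congr (Filter.Eventually.of_forall fun h => ?_)
    simp only [Pi.mul_apply]; ring
  · refine hI2.congr (Filter.Eventually.of_forall fun h => ?_)
    simp only [Pi.mul_apply]; ring
  · have t : Filter.Tendsto (fun h : ℝ => K * h ^ (1-α)) (nhdsWithin 0 (Ioi 0)) (nhds 0) := by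
      have : ContinuousAt (fun h : ℝ => K * h ^ (1-α)) 0 :=
        continuousAt_const.mul (continuousAt_id.rpow_const (Or.inr (by linarith)))
      have := this.tendsto
      simp only [zero_rpow (show 1 - α ≠ 0 by linarith), mul_zero] at this
      exact this.mono_left nhdsWithin_le_nhds
    refine squeeze_zero_norm' ?_ t
    filter_upwards [self_mem_nhdsWithin] with h hh
    have hh' : 0 < h := hh
    have hp : 0 < h ^ (-α) := rpow_pos_of_pos hh' _
    have e : h ^ (1-α) = |h| * h ^ (-α) := by
      rw [abs_of_pos hh']
      nth_rewrite 2 [← rpow_one h]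
      rw [← rpow_add hh']; congr 1
    simp only [Pi.mul_apply, norm_mul, norm_neg, Real.norm_eq_abs, abs_of_pos hp]
    rw [e, ← mul_assoc]
    exact mul_le_mul_of_nonneg_right (hl _ _) hp.le
  · have t : Filter.Tendsto (fun h : ℝ => M * h ^ (-α)) Filter.atTop (nhds 0) := by
      simpa using (tendsto_rpow_neg_atTop hα₀).const_mul M
    refine squeeze_zero_norm' ?_ t
    filter_upwards [Filter.eventually_gt_atTop 0] with h hh'
    have hp : 0 < h ^ (-α) := rpow_pos_of_pos hh' _
    simp only [Pi.mul_apply, norm_mul, norm_neg, Real.norm_eq_abs, abs_of_pos hp]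
    exact mul_le_mul_of_nonneg_right (hb _ _) hp.le

lemma aux_shear : MeasurePreserving (fun z : ℝ × ℝ => (z.1, z.1 - z.2)) := by
  have h1 := measurePreserving_prod_add (volume : Measure ℝ) (volume : Measure ℝ)
  have h2 := (MeasurePreserving.id (volume : Measure ℝ)).prod
    (Measure.measurePreserving_neg (volume : Measure ℝ))
  have := h1.comp h2
  have e : (fun z : ℝ × ℝ => (z.1, z.1 - z.2)) =
      (fun z : ℝ × ℝ => (z.1, z.1 + z.2)) ∘ Prod.map id Neg.neg := by
    ext z <;> simp [sub_eq_add_neg]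
  rw [e]
  exact this

theorem stmt_18 (α : ℝ) (hα₀ : 0 < α) (hα₁ : α < 1)
    (u : ℝ → ℝ) (hu : Integrable u)
    (hG : Integrable (fun q : ℝ × ℝ => |u q.1 - u q.2| / |q.1 - q.2| ^ (1 + α))) :
    ∃ v : ℝ → ℝ, Integrable v ∧
      (∀ φ : ℝ → ℝ, ContDiff ℝ (⊤ : ℕ∞) φ → HasCompactSupport φ →
        ∫ x, v x * φ x =
          ∫ x, u x *
            (-(1 / Real.Gamma (1 - α)) * ∫ y in Set.Ioi x, deriv φ y * (y - x) ^ (-α))) ∧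
      ∫ x, |v x| ≤ (α / Real.Gamma (1 - α)) *
        ∫ q : ℝ × ℝ, |u q.1 - u q.2| / |q.1 - q.2| ^ (1 + α) := by
  set c : ℝ := α / Real.Gamma (1 - α) with hcdef
  have hΓ : 0 < Real.Gamma (1 - α) := Real.Gamma_pos_of_pos (by linarith)
  have hc : 0 < c := div_pos hα₀ hΓ
  set G : ℝ × ℝ → ℝ := fun q => |u q.1 - u q.2| / |q.1 - q.2| ^ (1 + α) with hGdef
  set μ : Measure ℝ := volume.restrict (Ioi (0:ℝ)) with hμ
  set T : ℝ × ℝ → ℝ × ℝ := fun z => (z.1, z.1 - z.2) with hT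
  have hGT : Integrable (G ∘ T) := (aux_shear.integrable_comp hG.1).2 hG
  have hGTint : ∫ z, G (T z) = ∫ q, G q := by
    have hme : AEStronglyMeasurable G (Measure.map T volume) := by
      rw [aux_shear.map_eq]; exact hG.1
    rw [← integral_map aux_shear.measurable.aemeasurable hme, aux_shear.map_eq]
  have hprod : (volume : Measure ℝ).prod μ = (volume : Measure (ℝ × ℝ)).restrict (univ ×ˢ Ioi 0) := by
    rw [hμ, Measure.volume_eq_prod, ← Measure.prod_restrict, Measure.restrict_univ]
  set W : ℝ × ℝ → ℝ := fun z => (u z.1 - u (z.1 - z.2)) * z.2 ^ (-1-α) with hW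
  have hWG : ∀ z : ℝ × ℝ, 0 < z.2 → ‖W z‖ = G (T z) := by
    rintro ⟨x, h⟩ hh
    have hh : 0 < h := hh
    have hp : 0 < h ^ (-1-α) := rpow_pos_of_pos hh _
    simp only [hW, hGdef, hT, norm_mul, Real.norm_eq_abs, abs_of_pos hp]
    rw [sub_sub_cancel, abs_of_pos hh, div_eq_mul_inv, ← rpow_neg hh.le]
    congr 2; ring
  have hms : MeasurableSet ((univ : Set ℝ) ×ˢ Ioi (0:ℝ)) := MeasurableSet.univ.prod measurableSet_Ioi
  have hWae : ∀ᵐ z ∂((volume : Measure ℝ).prod μ), ‖W z‖ = G (T z) := by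
    rw [hprod]
    refine (ae_restrict_iff' hms).2 (Filter.Eventually.of_forall fun z hz => hWG z hz.2)
  have hGT' : Integrable (fun z => G (T z)) ((volume : Measure ℝ).prod μ) := by
    rw [hprod]; exact hGT.integrableOn
  have hWm : AEStronglyMeasurable W ((volume : Measure ℝ).prod μ) := by
    rw [hprod]
    refine AEStronglyMeasurable.restrict ?_
    have m1 : AEStronglyMeasurable (fun z : ℝ × ℝ => u z.1) volume := by
      rw [Measure.volume_eq_prod]; exact hu.1.comp_fst
    have m2 : AEStronglyMeasurable (fun z : ℝ × ℝ => u (z.1 - z.2)) volume := by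
      have : AEStronglyMeasurable (fun z : ℝ × ℝ => u z.2) volume := by
        rw [Measure.volume_eq_prod]; exact hu.1.comp_snd
      exact this.comp_measurePreserving aux_shear
    exact (m1.sub m2).mul (Measurable.aestronglyMeasurable (by fun_prop))
  have hWi : Integrable W ((volume : Measure ℝ).prod μ) :=
    hGT'.mono' hWm (hWae.mono fun z hz => hz.le)
  refine ⟨fun x => c * ∫ h, W (x, h) ∂μ, hWi.integral_prod_left.const_mul c, ?_, ?_⟩
  · intro φ hφ hφc
    obtain ⟨K, M, hK0, hM0, hd, hb, hl⟩ := aux_bounds φ hφ hφc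
    obtain ⟨B, hB⟩ := hφc.exists_bound_of_continuous hφ.continuous
    have hφcont := hφ.continuous
    -- right-hand side
    have hR : ∀ x, -(1 / Real.Gamma (1 - α)) * ∫ y in Set.Ioi x, deriv φ y * (y - x) ^ (-α) =
        c * ∫ h, (φ x - φ (x + h)) * h ^ (-1-α) ∂μ := by
      intro x
      have := aux_parts α hα₀ hα₁ φ hφ hφc x
      rw [hcdef, div_mul_eq_mul_div, this]; ring
    have hI1 : Integrable (Function.uncurry fun x h => W (x, h) * φ x)
        ((volume : Measure ℝ).prod μ) := by
      refine Integrable.mul_bdd (c := B) hWi ?_ (Filter.Eventually.of_forall fun z => hB _)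
      exact (hφcont.comp continuous_fst).aestronglyMeasurable
    have hI2 : Integrable (Function.uncurry fun x h => u x * ((φ x - φ (x + h)) * h ^ (-1-α)))
        ((volume : Measure ℝ).prod μ) := by
      have hk : Integrable _ μ := (aux_kernel α hα₀ hα₁ K M).integrableOn (s := Ioi 0)
      refine Integrable.mono' (hu.norm.mul_prod hk) ?_ ?_
      · refine AEStronglyMeasurable.mul (f := fun z : ℝ × ℝ => u z.1) hu.1.comp_fst ?_
        exact Measurable.aestronglyMeasurable (by fun_prop)
      · rw [hprod]
        refine (ae_restrict_iff' hms).2 (Filter.Eventually.of_forall fun z hz => ?_)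
        simp only [Function.uncurry, norm_mul (u z.1)]
        exact mul_le_mul_of_nonneg_left (aux_dom α K M _ z.2 hz.2 (hb _ _) (hl _ _)) (norm_nonneg _)
    simp only [hR]
    calc ∫ x, c * (∫ h, W (x, h) ∂μ) * φ x
        = c * ∫ x, ∫ h, W (x, h) * φ x ∂μ := by
          rw [← integral_const_mul]
          congr 1; ext x
          rw [integral_mul_const]; ring
      _ = c * ∫ h, (∫ x, W (x, h) * φ x) ∂μ := by rw [integral_integral_swap hI1]
      _ = c * ∫ h, (∫ x, u x * ((φ x - φ (x + h)) * h ^ (-1-α))) ∂μ := by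
          congr 2; ext h
          have a1 : Integrable (fun x => u x * φ x) :=
            hu.mul_bdd (c := B) hφcont.aestronglyMeasurable (Filter.Eventually.of_forall hB)
          have a2 : Integrable (fun x => u (x - h) * φ x) :=
            (hu.comp_sub_right h).mul_bdd (c := B) hφcont.aestronglyMeasurable
              (Filter.Eventually.of_forall hB)
          have a3 : Integrable (fun x => u x * φ (x + h)) :=
            hu.mul_bdd (c := B) (by fun_prop) (Filter.Eventually.of_forall fun x => hB _)
          have e : ∫ x, u (x - h) * φ x = ∫ x, u x * φ (x + h) := by
            rw [← integral_add_right_eq_self _ h]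
            simp
          calc _ = ∫ x, (u x * φ x - u (x - h) * φ x) * h ^ (-1-α) := by
                congr 1; ext x; simp only [hW]; ring
            _ = ∫ x, (u x * φ x - u x * φ (x + h)) * h ^ (-1-α) := by
                rw [integral_mul_const, integral_mul_const, integral_sub a1 a2,
                  integral_sub a1 a3, e]
            _ = _ := by congr 1; ext x; ring
      _ = c * ∫ x, ∫ h, u x * ((φ x - φ (x + h)) * h ^ (-1-α)) ∂μ := by
          rw [integral_integral_swap hI2]
      _ = _ := by
          rw [← integral_const_mul]
          congr 1; ext x
          rw [integral_const_mul]; ring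
  · calc ∫ x, |c * ∫ h, W (x, h) ∂μ| ≤ ∫ x, c * ∫ h, ‖W (x, h)‖ ∂μ := by
          refine integral_mono (hWi.integral_prod_left.const_mul c).abs
            (hWi.integral_norm_prod_left.const_mul c) fun x => ?_
          simp only [abs_mul, abs_of_pos hc]
          have hn := norm_integral_le_integral_norm (μ := μ) (fun h => W (x, h))
          rw [Real.norm_eq_abs] at hn
          exact mul_le_mul_of_nonneg_left hn hc.le
      _ = c * ∫ z, ‖W z‖ ∂((volume : Measure ℝ).prod μ) := by
          rw [integral_const_mul, integral_prod _ hWi.norm]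
      _ = c * ∫ z, G (T z) ∂((volume : Measure ℝ).prod μ) := by
          rw [integral_congr_ae hWae]
      _ ≤ c * ∫ z, G (T z) := by
          refine mul_le_mul_of_nonneg_left ?_ hc.le
          rw [hprod]
          refine setIntegral_le_integral hGT (Filter.Eventually.of_forall fun z => ?_)
          simp only [hGdef, Pi.zero_apply]
          positivity
      _ = _ := by rw [hGTint]
end
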